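/- arXiv:1209.3867 — 4 statements merged into one kernel-verified Lean document; each statement's English description precedes it below -/
import Mathlib

section
/- The second moment of the Chernoff density satisfies ∫_ℝ x² f(x) dx = −(1/(2πi)) ∫_{−i∞}^{i∞} Ai'(z)²/Ai(z)⁴ dz = −(1/(6πi)) ∫_{−i∞}^{i∞} z/Ai(z)² dz, i.e. it equals −(1/(2π)) ∫_ℝ Ai'(iy)²/Ai(iy)⁴ dy = −(1/(6π)) ∫_ℝ iy/Ai(iy)² dy. -/
theorem le_of_hasDerivAt_nonneg {f f' : ℝ → ℝ} {a : ℝ}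
    (hf : ∀ y, HasDerivAt f (f' y) y) (hf' : ∀ y, a ≤ y → 0 ≤ f' y) {y : ℝ} (hy : a ≤ y) :
    f a ≤ f y := by
  have hmono : MonotoneOn f (Set.Ici a) :=
    monotoneOn_of_hasDerivWithinAt_nonneg (convex_Ici a)
      (fun x _ => (hf x).continuousAt.continuousWithinAt)
      (fun x _ => (hf x).hasDerivWithinAt)
      (fun x hx => hf' x (interior_subset hx))
  exact hmono Set.self_mem_Ici hy hy

theorem pow_le_factorial_div_mul_exp {y : ℝ} (hy : 0 ≤ y) (k : ℕ) {c : ℝ} (hc : 0 < c) :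
    y ^ k ≤ (k.factorial / c ^ k) * Real.exp (c * y) := by
  have h := Real.pow_div_factorial_le_exp (c * y) (by positivity) k
  rw [mul_pow, div_le_iff₀ (by positivity)] at h
  rw [div_mul_eq_mul_div, le_div_iff₀ (by positivity)]
  linarith

/-- Growth on the positive half-line of a solution `u = p + i s` of `u'' = -i y u` with derivative
`v = m + i n`, whose initial data satisfy `Re (v ū) = 0` and `Im (v ū) < 0` at `0`. -/
theorem airy_growth {p s m n : ℝ → ℝ}
    (hp : ∀ y, HasDerivAt p (m y) y) (hs : ∀ y, HasDerivAt s (n y) y)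
    (hm : ∀ y, HasDerivAt m (y * s y) y) (hn : ∀ y, HasDerivAt n (-(y * p y)) y)
    (hE : p 0 * m 0 + s 0 * n 0 = 0) (hG : 0 < m 0 * s 0 - n 0 * p 0) :
    ∃ C : ℝ, 0 < C ∧ ∀ y : ℝ, 0 ≤ y →
      Real.exp (y / 2) ≤ C * (p y ^ 2 + s y ^ 2) ∧
      m y ^ 2 + n y ^ 2 ≤ C * Real.exp (y / 16) * (p y ^ 2 + s y ^ 2) := by
  set N : ℝ → ℝ := fun y => p y ^ 2 + s y ^ 2 with hNdef
  set V : ℝ → ℝ := fun y => m y ^ 2 + n y ^ 2 with hVdef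
  set E : ℝ → ℝ := fun y => p y * m y + s y * n y with hEdef
  set G : ℝ → ℝ := fun y => m y * s y - n y * p y with hGdef
  have dN : ∀ y, HasDerivAt N (2 * E y) y := fun y => by
    refine (((hp y).pow 2).add ((hs y).pow 2)).congr_deriv ?_
    simp only [hEdef]; push_cast; ring
  have dV : ∀ y, HasDerivAt V (2 * y * G y) y := fun y => by
    refine (((hm y).pow 2).add ((hn y).pow 2)).congr_deriv ?_
    simp only [hGdef]; push_cast; ring
  have dE : ∀ y, HasDerivAt E (V y) y := fun y => by
    refine (((hp y).mul (hm y)).add ((hs y).mul (hn y))).congr_deriv ?_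
    simp only [hVdef]; ring
  have dG : ∀ y, HasDerivAt G (y * N y) y := fun y => by
    refine (((hm y).mul (hs y)).sub ((hn y).mul (hp y))).congr_deriv ?_
    simp only [hNdef]; ring
  have N0 : ∀ y, 0 ≤ N y := fun y => by positivity
  have V0 : ∀ y, 0 ≤ V y := fun y => by positivity
  have E0 : E 0 = 0 := hE
  have G0 : 0 < G 0 := hG
  have hE0 : ∀ y, 0 ≤ y → 0 ≤ E y := fun y hy =>
    E0 ▸ le_of_hasDerivAt_nonneg dE (fun y _ => V0 y) hy
  have hN0 : 0 < N 0 := by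
    rcases (N0 0).lt_or_eq with h | h
    · exact h
    · exfalso
      have h1 : p 0 ^ 2 + s 0 ^ 2 = 0 := h.symm
      have h2 : p 0 = 0 := by nlinarith [sq_nonneg (p 0), sq_nonneg (s 0)]
      have h3 : s 0 = 0 := by nlinarith [sq_nonneg (p 0), sq_nonneg (s 0)]
      rw [h2, h3] at hG
      simp at hG
  -- polynomial upper bounds for `G` and `V`
  set B : ℝ := G 0 / N 0 with hB
  have B0 : 0 < B := by positivity
  have BN : B * N 0 = G 0 := div_mul_cancel₀ _ hN0.ne'
  have hGle : ∀ y, 0 ≤ y → G y ≤ (B + y ^ 2 / 2) * N y := fun y hy => by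
    have d : ∀ y, HasDerivAt (fun y => (B + y ^ 2 / 2) * N y - G y)
        (y * N y + (B + y ^ 2 / 2) * (2 * E y) - y * N y) y := fun y => by
      refine ((((((hasDerivAt_id y).pow 2).div_const 2).const_add B).mul (dN y)).sub
        (dG y)).congr_deriv ?_
      simp
    have := le_of_hasDerivAt_nonneg d (fun y hy => by
      have := hE0 y hy
      ring_nf; positivity) hy
    linarith
  set A : ℝ := V 0 / N 0 with hA
  have A0 : 0 ≤ A := div_nonneg (V0 0) (N0 0)
  have AN : A * N 0 = V 0 := div_mul_cancel₀ _ hN0.ne'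
  have hVle : ∀ y, 0 ≤ y → V y ≤ (A + B * y ^ 2 + y ^ 4 / 4) * N y := fun y hy => by
    have d : ∀ y, HasDerivAt (fun y => (A + B * y ^ 2 + y ^ 4 / 4) * N y - V y)
        ((2 * B * y + y ^ 3) * N y + (A + B * y ^ 2 + y ^ 4 / 4) * (2 * E y) - 2 * y * G y) y :=
      fun y => by
      refine ((((((((hasDerivAt_id y).pow 2).const_mul B).const_add A).add
        (((hasDerivAt_id y).pow 4).div_const 4)).mul (dN y)).sub (dV y))).congr_deriv ?_
      simp; left; ring
    have := le_of_hasDerivAt_nonneg d (fun y hy => by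
      have h1 := hE0 y hy
      have h2 := mul_le_mul_of_nonneg_left (hGle y hy) (by positivity : 0 ≤ 2 * y)
      have h3 : 0 ≤ (A + B * y ^ 2 + y ^ 4 / 4) * (2 * E y) := by positivity
      nlinarith) hy
    linarith
  -- exponential lower bound for `E + G`
  have dP : ∀ y, HasDerivAt (fun y => E y + G y) (V y + y * N y) y := fun y => (dE y).add (dG y)
  have hP0 : ∀ y, 0 ≤ y → G 0 ≤ E y + G y := fun y hy => by
    have := le_of_hasDerivAt_nonneg dP
      (fun y hy => add_nonneg (V0 y) (mul_nonneg hy (N0 y))) hy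
    simpa [E0] using this
  have hP : ∀ y, 0 ≤ y → G 0 * Real.exp (y - 1) ≤ E y + G y := fun y hy => by
    rcases le_total y 1 with h1 | h1
    · refine le_trans ?_ (hP0 y hy)
      exact mul_le_of_le_one_right G0.le (Real.exp_le_one_iff.2 (by linarith))
    · have d : ∀ y, HasDerivAt (fun y => (E y + G y) * Real.exp (1 - y))
          ((V y + y * N y) * Real.exp (1 - y) + (E y + G y) * (Real.exp (1 - y) * (-1))) y :=
        fun y => (dP y).mul (((hasDerivAt_id y).const_sub 1).exp)
      have := le_of_hasDerivAt_nonneg d (fun y hy => by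
        have h2 : 0 ≤ V y + y * N y - (E y + G y) := by
          have h3 : N y ≤ y * N y := le_mul_of_one_le_left (N0 y) hy
          have h4 : 0 ≤ V y + N y - (E y + G y) := by
            simp only [hVdef, hNdef, hEdef, hGdef]
            nlinarith [sq_nonneg (p y - m y / 2 + n y / 2), sq_nonneg (s y - n y / 2 - m y / 2),
              sq_nonneg (m y), sq_nonneg (n y)]
          linarith
        have := mul_nonneg h2 (Real.exp_pos (1 - y)).le
        linarith) h1
      simp only [sub_self, Real.exp_zero, mul_one] at this
      have h2 := (hP0 1 zero_le_one).trans this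
      calc G 0 * Real.exp (y - 1) ≤ (E y + G y) * Real.exp (1 - y) * Real.exp (y - 1) := by gcongr
        _ = E y + G y := by
          rw [mul_assoc, ← Real.exp_add]; simp
  -- exponential lower bound for `N`
  set c : ℝ := min (G 0 * Real.exp (-1)) (N 0 / 2) with hc
  have c0 : 0 < c := lt_min (by positivity) (by positivity)
  have hNge : ∀ y, 0 ≤ y → c * Real.exp y ≤ (1 / 2 + B * y + y ^ 3 / 6) * N y := fun y hy => by
    have d : ∀ y, HasDerivAt (fun y => (1 / 2 + B * y + y ^ 3 / 6) * N y - c * Real.exp y)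
        ((B + y ^ 2 / 2) * N y + (1 / 2 + B * y + y ^ 3 / 6) * (2 * E y) - c * Real.exp y) y :=
      fun y => by
      refine ((((((hasDerivAt_id y).const_mul B).const_add (1 / 2)).add
        (((hasDerivAt_id y).pow 3).div_const 6)).mul (dN y)).sub
        ((Real.hasDerivAt_exp y).const_mul c)).congr_deriv ?_
      simp; left; ring
    have := le_of_hasDerivAt_nonneg d (fun y hy => by
      have h1 := hE0 y hy
      have h2 := hGle y hy
      have h3 := hP y hy
      have h4 : c * Real.exp y ≤ G 0 * Real.exp (y - 1) := by
        rw [sub_eq_add_neg, add_comm, Real.exp_add, ← mul_assoc]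
        exact mul_le_mul_of_nonneg_right (min_le_left _ _) (Real.exp_pos y).le
      have h5 : 0 ≤ (B * y + y ^ 3 / 6) * E y := by positivity
      nlinarith) hy
    have h6 : c ≤ N 0 / 2 := min_le_right _ _
    simp at this
    linarith
  have e1 := fun (y : ℝ) (hy : 0 ≤ y) =>
    pow_le_factorial_div_mul_exp hy 1 (c := 1 / 2) (by norm_num)
  have e3 := fun (y : ℝ) (hy : 0 ≤ y) =>
    pow_le_factorial_div_mul_exp hy 3 (c := 1 / 2) (by norm_num)
  have e2 := fun (y : ℝ) (hy : 0 ≤ y) =>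
    pow_le_factorial_div_mul_exp hy 2 (c := 1 / 16) (by norm_num)
  have e4 := fun (y : ℝ) (hy : 0 ≤ y) =>
    pow_le_factorial_div_mul_exp hy 4 (c := 1 / 16) (by norm_num)
  have K1 : ∃ K : ℝ, 0 < K ∧ ∀ y, 0 ≤ y →
      1 / 2 + B * y + y ^ 3 / 6 ≤ K * Real.exp (1 / 2 * y) :=
    ⟨1 / 2 + B * (((Nat.factorial 1 : ℕ) : ℝ) / (1 / 2) ^ 1) +
        (((Nat.factorial 3 : ℕ) : ℝ) / (1 / 2) ^ 3) / 6, by positivity, fun y hy => by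
      have h0 : 1 ≤ Real.exp (1 / 2 * y) := Real.one_le_exp (by positivity)
      have h1 := mul_le_mul_of_nonneg_left (e1 y hy) B0.le
      have h3 := e3 y hy
      rw [pow_one] at h1
      linarith⟩
  have K2 : ∃ K : ℝ, 0 < K ∧ ∀ y, 0 ≤ y →
      A + B * y ^ 2 + y ^ 4 / 4 ≤ K * Real.exp (1 / 16 * y) :=
    ⟨A + B * (((Nat.factorial 2 : ℕ) : ℝ) / (1 / 16) ^ 2) +
            (((Nat.factorial 4 : ℕ) : ℝ) / (1 / 16) ^ 4) / 4, by positivity, fun y hy => by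
      have h0 : 1 ≤ Real.exp (1 / 16 * y) := Real.one_le_exp (by positivity)
      have h1 := mul_le_mul_of_nonneg_left (e2 y hy) B0.le
      have h2 := mul_le_mul_of_nonneg_left h0 A0
      have h3 := e4 y hy
      linarith⟩
  obtain ⟨K₁, hK₁, h₁⟩ := K1
  obtain ⟨K₂, hK₂, h₂⟩ := K2
  refine ⟨K₁ / c + K₂, by positivity, fun y hy => ⟨?_, ?_⟩⟩
  · have h := (hNge y hy).trans (mul_le_mul_of_nonneg_right (h₁ y hy) (N0 y))
    have h' : Real.exp y = Real.exp (1 / 2 * y) * Real.exp (1 / 2 * y) := by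
      rw [← Real.exp_add]; ring_nf
    have hx := Real.exp_pos (1 / 2 * y)
    have h3 : c * Real.exp (1 / 2 * y) ≤ K₁ * N y := by
      refine le_of_mul_le_mul_right ?_ hx
      rw [h'] at h
      linarith
    have h4 : Real.exp (1 / 2 * y) ≤ K₁ / c * N y := by
      rw [div_mul_eq_mul_div K₁, le_div_iff₀ c0]; linarith
    have h5 : 0 ≤ K₂ * N y := mul_nonneg hK₂.le (N0 y)
    rw [show y / 2 = 1 / 2 * y by ring]
    linarith
  · have h := (hVle y hy).trans (mul_le_mul_of_nonneg_right (h₂ y hy) (N0 y))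
    have h5 : 0 ≤ K₁ / c * Real.exp (1 / 16 * y) * N y :=
      mul_nonneg (by positivity) (N0 y)
    rw [show y / 16 = 1 / 16 * y by ring]
    linarith

theorem airy_growth_complex {u v : ℝ → ℂ} (hu : ∀ y, HasDerivAt u (v y) y)
    (hv : ∀ y : ℝ, HasDerivAt v (-(Complex.I * y * u y)) y) {α β : ℝ}
    (hu0 : u 0 = α) (hv0 : v 0 = Complex.I * β) (hαβ : α * β < 0) :
    ∃ C : ℝ, 0 < C ∧ ∀ y : ℝ, 0 ≤ y →
      Real.exp (y / 2) ≤ C * ‖u y‖ ^ 2 ∧ ‖v y‖ ^ 2 ≤ C * Real.exp (y / 16) * ‖u y‖ ^ 2 := by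
  have hre : ∀ {w : ℝ → ℂ} {w' : ℂ} {y : ℝ}, HasDerivAt w w' y →
      HasDerivAt (fun x => (w x).re) w'.re y := fun h =>
    Complex.reCLM.hasFDerivAt.comp_hasDerivAt _ h
  have him : ∀ {w : ℝ → ℂ} {w' : ℂ} {y : ℝ}, HasDerivAt w w' y →
      HasDerivAt (fun x => (w x).im) w'.im y := fun h =>
    Complex.imCLM.hasFDerivAt.comp_hasDerivAt _ h
  have hnorm : ∀ z : ℂ, ‖z‖ ^ 2 = z.re ^ 2 + z.im ^ 2 := fun z => by
    rw [Complex.sq_norm, Complex.normSq_apply]; ring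
  simp only [hnorm]
  refine airy_growth (fun y => hre (hu y)) (fun y => him (hu y))
    (fun y => (hre (hv y)).congr_deriv (by simp))
    (fun y => (him (hv y)).congr_deriv (by simp)) ?_ ?_
  · simp [hu0, hv0]
  · simp [hu0, hv0]; linarith

theorem airy_bounds {u v : ℝ → ℂ} (hu : ∀ y, HasDerivAt u (v y) y)
    (hv : ∀ y : ℝ, HasDerivAt v (-(Complex.I * y * u y)) y) {α β : ℝ}
    (hu0 : u 0 = α) (hv0 : v 0 = Complex.I * β) (hαβ : α * β < 0) :
    ∃ C : ℝ, 0 < C ∧ ∀ y : ℝ, u y ≠ 0 ∧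
      ‖v y / u y‖ ≤ C * Real.exp (|y| / 32) ∧ ‖(u y)⁻¹‖ ≤ C * Real.exp (-(8 * (|y| / 32))) := by
  obtain ⟨C₁, hC₁, h₁⟩ := airy_growth_complex hu hv hu0 hv0 hαβ
  obtain ⟨C₂, hC₂, h₂⟩ := airy_growth_complex
    (u := fun y => (starRingEnd ℂ) (u (-y))) (v := fun y => -(starRingEnd ℂ) (v (-y)))
    (fun y => by
      have := (Complex.conjCLE.toContinuousLinearMap.hasFDerivAt).comp_hasDerivAt y
        ((hu (-y)).scomp y (hasDerivAt_neg y))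
      refine this.congr_deriv ?_
      simp)
    (fun y => by
      have := ((Complex.conjCLE.toContinuousLinearMap.hasFDerivAt).comp_hasDerivAt y
        ((hv (-y)).scomp y (hasDerivAt_neg y))).neg
      refine this.congr_deriv ?_
      simp)
    (α := α) (β := β) (by simp [hu0]) (by simp [hv0]) hαβ
  have key : ∀ y : ℝ, Real.exp (|y| / 2) ≤ (C₁ + C₂) * ‖u y‖ ^ 2 ∧
      ‖v y‖ ^ 2 ≤ (C₁ + C₂) * Real.exp (|y| / 16) * ‖u y‖ ^ 2 := fun y => by
    have i1 : 0 ≤ C₁ * ‖u y‖ ^ 2 := by positivity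
    have i2 : 0 ≤ C₂ * ‖u y‖ ^ 2 := by positivity
    have i3 : 0 ≤ C₁ * Real.exp (|y| / 16) * ‖u y‖ ^ 2 := by positivity
    have i4 : 0 ≤ C₂ * Real.exp (|y| / 16) * ‖u y‖ ^ 2 := by positivity
    rcases le_total 0 y with hy | hy
    · obtain ⟨h, h'⟩ := h₁ y hy
      rw [abs_of_nonneg hy] at *
      constructor <;> linarith
    · obtain ⟨h, h'⟩ := h₂ (-y) (by linarith)
      simp only [neg_neg, norm_neg, RCLike.norm_conj] at h h'
      rw [abs_of_nonpos hy] at *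
      constructor <;> linarith
  refine ⟨C₁ + C₂ + 1, by positivity, fun y => ?_⟩
  obtain ⟨h, h'⟩ := key y
  have hne : u y ≠ 0 := fun h0 => by
    rw [h0] at h
    simp at h
    exact absurd h (not_le.2 (Real.exp_pos _))
  have hpos : 0 < ‖u y‖ := norm_pos_iff.2 hne
  have hC : C₁ + C₂ ≤ (C₁ + C₂ + 1) ^ 2 := by nlinarith
  refine ⟨hne, ?_, ?_⟩
  · rw [norm_div, div_le_iff₀ hpos]
    refine le_of_sq_le_sq ?_ (by positivity)
    rw [mul_pow, mul_pow, ← Real.exp_nat_mul]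
    refine h'.trans ?_
    rw [show ((2 : ℕ) : ℝ) * (|y| / 32) = |y| / 16 by push_cast; ring]
    gcongr
  · rw [norm_inv, inv_le_iff_one_le_mul₀ hpos]
    refine le_of_sq_le_sq ?_ (by positivity)
    rw [mul_pow, mul_pow, ← Real.exp_nat_mul,
      show ((2 : ℕ) : ℝ) * (-(8 * (|y| / 32))) = -(|y| / 2) by push_cast; ring, Real.exp_neg,
      one_pow, mul_assoc, mul_comm _ (‖u y‖ ^ 2), ← mul_assoc, ← div_eq_mul_inv,
      le_div_iff₀ (Real.exp_pos _), one_mul]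
    refine h.trans ?_
    gcongr

theorem integrable_of_norm_le_exp_neg_abs {F : ℝ → ℂ} (hF : Continuous F) {K b : ℝ} (hb : 0 < b)
    (h : ∀ y, ‖F y‖ ≤ K * Real.exp (-(b * |y|))) : MeasureTheory.Integrable F := by
  have hK : 0 ≤ K := by
    have := (norm_nonneg _).trans (h 0)
    simpa using this
  refine (integrable_inv_one_add_sq.const_mul (K * (1 + (Nat.factorial 2 : ℕ) / b ^ 2))).mono'
    hF.aestronglyMeasurable (Filter.Eventually.of_forall fun y => (h y).trans ?_)
  have h1 := pow_le_factorial_div_mul_exp (abs_nonneg y) 2 hb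
  have h2 : 1 ≤ Real.exp (b * |y|) := Real.one_le_exp (by positivity)
  rw [sq_abs] at h1
  rw [mul_assoc, Real.exp_neg]
  refine mul_le_mul_of_nonneg_left ?_ hK
  rw [← div_eq_mul_inv, inv_eq_one_div, div_le_div_iff₀ (Real.exp_pos _) (by positivity)]
  linarith

theorem integrable_monomial {q r : ℝ → ℂ} (hq : Continuous q) (hr : Continuous r) {C : ℝ}
    (h : ∀ y : ℝ, ‖q y‖ ≤ C * Real.exp (|y| / 32) ∧
      ‖r y‖ ≤ C * Real.exp (-(8 * (|y| / 32)))) (a b c : ℕ) (habc : a + b < 8 * c) :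
    MeasureTheory.Integrable (fun y : ℝ => (y : ℂ) ^ a * q y ^ b * r y ^ c) := by
  refine integrable_of_norm_le_exp_neg_abs (by fun_prop) (K := 32 ^ a * C ^ b * C ^ c)
    (b := (8 * c - (a + b)) / 32) ?_ fun y => ?_
  · have : ((a + b : ℕ) : ℝ) < (8 * c : ℕ) := by exact_mod_cast habc
    push_cast at this
    linarith
  · obtain ⟨h1, h2⟩ := h y
    have h0 : ‖(y : ℂ)‖ ≤ 32 * Real.exp (|y| / 32) := by
      have := pow_le_factorial_div_mul_exp (abs_nonneg y) 1 (c := 1 / 32) (by norm_num)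
      rw [Complex.norm_real, Real.norm_eq_abs]
      rw [show |y| / 32 = 1 / 32 * |y| by ring]
      norm_num at this ⊢
      linarith
    rw [norm_mul, norm_mul, norm_pow, norm_pow, norm_pow]
    have hC : 0 ≤ C * Real.exp (|y| / 32) := (norm_nonneg _).trans h1
    calc ‖(y : ℂ)‖ ^ a * ‖q y‖ ^ b * ‖r y‖ ^ c
        ≤ (32 * Real.exp (|y| / 32)) ^ a * (C * Real.exp (|y| / 32)) ^ b *
          (C * Real.exp (-(8 * (|y| / 32)))) ^ c := by gcongr
      _ = 32 ^ a * C ^ b * C ^ c * Real.exp (-((8 * c - (a + b)) / 32 * |y|)) := by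
        simp only [mul_pow, ← Real.exp_nat_mul]
        rw [show -((8 * (c : ℝ) - (a + b)) / 32 * |y|) = a * (|y| / 32) + b * (|y| / 32) +
          c * (-(8 * (|y| / 32))) by ring, Real.exp_add, Real.exp_add]
        ring

open scoped FourierTransform in
theorem continuous_fourier {F : ℝ → ℂ} (hF : MeasureTheory.Integrable F) : Continuous (𝓕 F) :=
  VectorFourier.fourierIntegral_continuous Real.continuous_fourierChar
    (by fun_prop) hF

open scoped FourierTransform in
/-- Plancherel's identity, in bilinear form, for the derivative of a function. -/
theorem integral_fourier_mul_fourier_neg {r r₁ r₂ r₃ : ℝ → ℂ}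
    (h₁ : ∀ y, HasDerivAt r (r₁ y) y) (h₂ : ∀ y, HasDerivAt r₁ (r₂ y) y)
    (h₃ : ∀ y, HasDerivAt r₂ (r₃ y) y)
    (i₀ : MeasureTheory.Integrable r) (i₁ : MeasureTheory.Integrable r₁)
    (i₂ : MeasureTheory.Integrable r₂) (i₃ : MeasureTheory.Integrable r₃) :
    ∫ x : ℝ, (2 * Real.pi * x) ^ 2 * (𝓕 r x * 𝓕 r (-x)) = ∫ y, r₁ y ^ 2 := by
  have deriv_eq : ∀ {F F' : ℝ → ℂ}, (∀ y, HasDerivAt F (F' y) y) → MeasureTheory.Integrable F →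
      MeasureTheory.Integrable F' → ∀ x, 𝓕 F' x = (2 * Real.pi * Complex.I * x) * 𝓕 F x := by
    intro F F' h i i' x
    have hd : deriv F = F' := funext fun y => (h y).deriv
    have := Real.fourier_deriv i (fun y => (h y).differentiableAt) (hd ▸ i')
    rw [hd] at this
    simp only [this, smul_eq_mul]
  have norm_le : ∀ (F : ℝ → ℂ) x, ‖𝓕 F x‖ ≤ ∫ y, ‖F y‖ := fun F x =>
    VectorFourier.norm_fourierIntegral_le_integral_norm _ _ _ _ _
  have hint : MeasureTheory.Integrable (𝓕 r₁) := by
    refine (integrable_inv_one_add_sq.const_mul ((∫ y, ‖r₁ y‖) + ∫ y, ‖r₃ y‖)).mono'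
      (continuous_fourier i₁).aestronglyMeasurable (Filter.Eventually.of_forall fun x => ?_)
    have e := norm_le r₃ x
    rw [deriv_eq h₃ i₂ i₃, deriv_eq h₂ i₁ i₂, ← mul_assoc, norm_mul] at e
    have e' : ‖(2 * Real.pi * Complex.I * x) * (2 * Real.pi * Complex.I * x)‖
        = (2 * Real.pi) ^ 2 * x ^ 2 := by
      simp only [norm_mul, Complex.norm_I, Complex.norm_real, Real.norm_eq_abs,
        Complex.norm_ofNat, abs_of_pos Real.pi_pos]
      rw [← sq_abs x]; ring
    rw [e'] at e
    have hpi : 1 ≤ (2 * Real.pi) ^ 2 := one_le_pow₀ (by linarith [Real.pi_gt_three])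
    have e2 : x ^ 2 * ‖𝓕 r₁ x‖ ≤ (2 * Real.pi) ^ 2 * x ^ 2 * ‖𝓕 r₁ x‖ := by
      rw [mul_assoc]
      exact le_mul_of_one_le_left (by positivity) hpi
    rw [← div_eq_mul_inv, le_div_iff₀ (by positivity)]
    linarith [norm_le r₁ x]
  have inv_int : MeasureTheory.Integrable (𝓕⁻ r₁) := by
    have : 𝓕⁻ r₁ = fun x => 𝓕 r₁ (-x) := funext fun x => Real.fourierInv_eq_fourier_neg _ _
    rw [this]
    exact hint.comp_neg
  have hflip := VectorFourier.integral_fourierIntegral_smul_eq_flip (L := innerₗ ℝ)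
    Real.continuous_fourierChar (by fun_prop) i₁ inv_int
  have inv_eq : 𝓕 (𝓕⁻ r₁) = r₁ :=
    Continuous.fourier_fourierInv_eq
      (continuous_iff_continuousAt.2 fun y => (h₂ y).continuousAt) i₁ hint
  have hmain : ∫ x, 𝓕 r₁ x * 𝓕⁻ r₁ x = ∫ y, r₁ y * 𝓕 (𝓕⁻ r₁) y := by
    rw [flip_innerₗ] at hflip
    exact hflip
  rw [inv_eq] at hmain
  calc _ = ∫ x, 𝓕 r₁ x * 𝓕⁻ r₁ x := by
        refine MeasureTheory.integral_congr_ae (Filter.Eventually.of_forall fun x => ?_)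
        simp only
        rw [Real.fourierInv_eq_fourier_neg, deriv_eq h₁ i₀ i₁, deriv_eq h₁ i₀ i₁]
        push_cast
        linear_combination ((2 * Real.pi * x : ℂ) ^ 2 * (𝓕 r x * 𝓕 r (-x))) * Complex.I_sq
    _ = _ := by
      rw [hmain]
      simp only [sq]

theorem hasDerivAt_comp_I_mul {F : ℂ → ℂ} (hF : Differentiable ℂ F) (y : ℝ) :
    HasDerivAt (fun y : ℝ => F (Complex.I * y)) (Complex.I * deriv F (Complex.I * y)) y := by
  have h1 : HasDerivAt (fun z : ℂ => F (Complex.I * z))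
      (deriv F (Complex.I * y) * (Complex.I * 1)) (y : ℂ) :=
    HasDerivAt.comp (h₂ := F) (y : ℂ) (hF _).hasDerivAt
      ((hasDerivAt_id (y : ℂ)).const_mul Complex.I)
  exact h1.comp_ofReal.congr_deriv (by ring)

open scoped FourierTransform in
theorem inverse_fourier_integral_eq {A : ℂ → ℂ} (x : ℝ) :
    ∫ t : ℝ, Complex.exp (-(Complex.I * t * x)) * ((Real.sqrt 2 : ℂ) / A (Complex.I * t)) =
      Real.sqrt 2 * 𝓕 (fun y : ℝ => (A (Complex.I * y))⁻¹) (x / (2 * Real.pi)) := by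
  rw [Real.fourier_real_eq_integral_exp_smul, ← MeasureTheory.integral_const_mul]
  refine MeasureTheory.integral_congr_ae (Filter.Eventually.of_forall fun t => ?_)
  have hpi : (Real.pi : ℂ) ≠ 0 := by exact_mod_cast Real.pi_ne_zero
  have he : ((-2 * Real.pi * t * (x / (2 * Real.pi)) : ℝ) : ℂ) * Complex.I =
      -(Complex.I * t * x) := by
    push_cast
    field_simp
  simp only [smul_eq_mul]
  rw [he]
  ring

theorem chernoff_second_moment (Ai : ℂ → ℂ)
    (hAi_d1 : Differentiable ℂ Ai)
    (hAi_d2 : Differentiable ℂ (deriv Ai))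
    (hAi_ode : ∀ z : ℂ, deriv (deriv Ai) z = z * Ai z)
    (hAi_0 : Ai 0 = (3 : ℂ) ^ (-(2 : ℂ) / 3) / Complex.Gamma (2 / 3))
    (hAi_0' : deriv Ai 0 = -(3 : ℂ) ^ (-(1 : ℂ) / 3) / Complex.Gamma (1 / 3))
    (hAi_zeros : ∀ z : ℂ, Ai z = 0 → ∃ x : ℝ, x < 0 ∧ z = (x : ℂ))
    (g : ℝ → ℝ)
    (hg : ∀ x : ℝ, (g x : ℂ) =
      (1 / (2 * (Real.pi : ℂ))) *
        ∫ t : ℝ, Complex.exp (-(Complex.I * t * x)) * ((Real.sqrt 2 : ℂ) / Ai (Complex.I * t)))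
    (f : ℝ → ℝ)
    (hf : ∀ x : ℝ, f x = (1 / 2) * g x * g (-x)) :
    ((∫ x : ℝ, x ^ 2 * f x : ℝ) : ℂ) =
        -((1 / (2 * (Real.pi : ℂ))) *
          ∫ y : ℝ, (deriv Ai (Complex.I * y)) ^ 2 / (Ai (Complex.I * y)) ^ 4) ∧
      ((∫ x : ℝ, x ^ 2 * f x : ℝ) : ℂ) =
        -((1 / (6 * (Real.pi : ℂ))) *
          ∫ y : ℝ, (Complex.I * y) / (Ai (Complex.I * y)) ^ 2) := by
  have hpi : (Real.pi : ℂ) ≠ 0 := by exact_mod_cast Real.pi_ne_zero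
  -- initial values are real, of opposite signs
  have hα : Ai 0 = ((3 ^ (-(2 : ℝ) / 3) / Real.Gamma (2 / 3) : ℝ) : ℂ) := by
    rw [hAi_0]
    push_cast [← Complex.Gamma_ofReal, Complex.ofReal_cpow (by norm_num : (0 : ℝ) ≤ 3)]
    rfl
  have hβ : deriv Ai 0 = ((-3 ^ (-(1 : ℝ) / 3) / Real.Gamma (1 / 3) : ℝ) : ℂ) := by
    rw [hAi_0']
    push_cast [← Complex.Gamma_ofReal, Complex.ofReal_cpow (by norm_num : (0 : ℝ) ≤ 3)]
    rfl
  have hαβ : (3 ^ (-(2 : ℝ) / 3) / Real.Gamma (2 / 3)) *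
      (-3 ^ (-(1 : ℝ) / 3) / Real.Gamma (1 / 3)) < 0 := by
    have g1 := Real.Gamma_pos_of_pos (show (0 : ℝ) < 1 / 3 by norm_num)
    have g2 := Real.Gamma_pos_of_pos (show (0 : ℝ) < 2 / 3 by norm_num)
    exact mul_neg_of_pos_of_neg (by positivity)
      (div_neg_of_neg_of_pos (neg_neg_of_pos (by positivity)) g1)
  set u : ℝ → ℂ := fun y => Ai (Complex.I * y) with hu_def
  set v : ℝ → ℂ := fun y => Complex.I * deriv Ai (Complex.I * y) with hv_def
  have hu : ∀ y, HasDerivAt u (v y) y := hasDerivAt_comp_I_mul hAi_d1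
  have hv : ∀ y : ℝ, HasDerivAt v (-(Complex.I * y * u y)) y := fun y =>
    ((hasDerivAt_comp_I_mul hAi_d2 y).const_mul Complex.I).congr_deriv (by
      rw [hAi_ode, ← mul_assoc, Complex.I_mul_I, neg_one_mul])
  obtain ⟨C, -, hC⟩ := airy_bounds hu hv (by simpa [hu_def] using hα)
    (by simp only [hv_def, Complex.ofReal_zero, mul_zero, hβ]) hαβ
  have hne : ∀ y, u y ≠ 0 := fun y => (hC y).1
  set r : ℝ → ℂ := fun y => (u y)⁻¹ with hr_def
  set q : ℝ → ℂ := fun y => v y / u y with hq_def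
  have hr : ∀ y, HasDerivAt r (-(q y * r y)) y := fun y =>
    ((hu y).inv (hne y)).congr_deriv (by
      have := hne y
      simp only [hq_def, hr_def]; field_simp)
  have hq : ∀ y : ℝ, HasDerivAt q (-(Complex.I * y) - q y ^ 2) y := fun y =>
    ((hv y).div (hu y) (hne y)).congr_deriv (by
      have := hne y
      simp only [hq_def]; field_simp)
  have hmon := integrable_monomial
    (continuous_iff_continuousAt.2 fun y => (hq y).continuousAt)
    (continuous_iff_continuousAt.2 fun y => (hr y).continuousAt) (fun y => (hC y).2)
  have hr2 : ∀ y : ℝ, HasDerivAt (fun y => -(q y * r y))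
      ((Complex.I * y + 2 * q y ^ 2) * r y) y := fun y =>
    ((hq y).mul (hr y)).neg.congr_deriv (by ring)
  have hr3 : ∀ y : ℝ, HasDerivAt (fun y : ℝ => (Complex.I * y + 2 * q y ^ 2) * r y)
      ((Complex.I - 5 * Complex.I * y * q y - 6 * q y ^ 3) * r y) y := fun y =>
    (((Complex.ofRealCLM.hasDerivAt.const_mul Complex.I).add
      (((hq y).pow 2).const_mul 2)).mul (hr y)).congr_deriv (by
        simp; ring)
  have hplan := integral_fourier_mul_fourier_neg hr hr2 hr3
    ((hmon 0 0 1 (by norm_num)).congr (Filter.Eventually.of_forall fun y => by simp))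
    ((hmon 0 1 1 (by norm_num)).neg.congr (Filter.Eventually.of_forall fun y => by simp))
    ((((hmon 1 0 1 (by norm_num)).const_mul Complex.I).add
      ((hmon 0 2 1 (by norm_num)).const_mul 2)).congr
        (Filter.Eventually.of_forall fun y => by simp; ring))
    (((((hmon 0 0 1 (by norm_num)).const_mul Complex.I).sub
      ((hmon 1 1 1 (by norm_num)).const_mul (5 * Complex.I))).sub
      ((hmon 0 3 1 (by norm_num)).const_mul 6)).congr
        (Filter.Eventually.of_forall fun y => by simp; ring))
  have hfirst : ((∫ x : ℝ, x ^ 2 * f x : ℝ) : ℂ) =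
      1 / (2 * Real.pi) * ∫ y, (-(q y * r y)) ^ 2 := by
    rw [← hplan, ← integral_complex_ofReal]
    have hg' : ∀ x, (g x : ℂ) = (1 / (2 * (Real.pi : ℂ))) *
        (Real.sqrt 2 * FourierTransform.fourier r (x / (2 * Real.pi))) := fun x => by
      rw [hg, inverse_fourier_integral_eq]
    have hsqrt : (Real.sqrt 2 : ℂ) ^ 2 = 2 := by
      exact_mod_cast Real.sq_sqrt (zero_le_two)
    have hcomp := MeasureTheory.Measure.integral_comp_div (fun x : ℝ =>
      (2 * Real.pi * x : ℂ) ^ 2 *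
        (FourierTransform.fourier r x * FourierTransform.fourier r (-x))) (2 * Real.pi)
    rw [abs_of_pos (by positivity), Complex.real_smul] at hcomp
    have hc : (1 / (2 * Real.pi) : ℂ) = 1 / (2 * Real.pi) ^ 2 * ((2 * Real.pi : ℝ) : ℂ) := by
      push_cast
      field_simp
    rw [hc, mul_assoc, ← hcomp, ← MeasureTheory.integral_const_mul]
    refine MeasureTheory.integral_congr_ae (Filter.Eventually.of_forall fun x => ?_)
    simp only
    rw [hf]
    push_cast
    rw [hg', hg', neg_div]
    have hx : (2 * Real.pi * (x / (2 * Real.pi)) : ℂ) = x := by field_simp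
    rw [hx]
    linear_combination (1 / 2 * x ^ 2 * (1 / (2 * (Real.pi : ℂ))) ^ 2 *
      (FourierTransform.fourier r (x / (2 * Real.pi)) *
        FourierTransform.fourier r (-(x / (2 * Real.pi))))) * hsqrt
  have hsq : ∀ y : ℝ, (-(q y * r y)) ^ 2 =
      -((deriv Ai (Complex.I * y)) ^ 2 / (Ai (Complex.I * y)) ^ 4) := fun y => by
    have h := hne y
    simp only [hu_def] at h
    simp only [hq_def, hr_def, hu_def, hv_def]
    field_simp
    rw [Complex.I_sq]
    ring
  have hzero := MeasureTheory.integral_eq_zero_of_hasDerivAt_of_integrable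
    (f := fun y => q y * r y ^ 2)
    (f' := fun y : ℝ => -(Complex.I * (y * r y ^ 2)) - 3 * (-(q y * r y)) ^ 2)
    (fun y => ((hq y).mul ((hr y).pow 2)).congr_deriv (by simp; ring))
    (((((hmon 1 0 2 (by norm_num)).const_mul Complex.I)).neg.sub
      ((hmon 0 2 2 (by norm_num)).const_mul 3)).congr
        (Filter.Eventually.of_forall fun y => by simp; ring))
    ((hmon 0 1 2 (by norm_num)).congr (Filter.Eventually.of_forall fun y => by simp))
  rw [MeasureTheory.integral_sub
    (((hmon 1 0 2 (by norm_num)).const_mul Complex.I).neg.congr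
      (Filter.Eventually.of_forall fun y => by simp))
    (((hmon 0 2 2 (by norm_num)).const_mul 3).congr
      (Filter.Eventually.of_forall fun y => by simp; ring)),
    MeasureTheory.integral_neg, MeasureTheory.integral_const_mul 3] at hzero
  constructor
  · rw [hfirst]
    simp only [hsq]
    rw [MeasureTheory.integral_neg, mul_neg]
  · have h3 : ∫ y : ℝ, (Complex.I * y) / (Ai (Complex.I * y)) ^ 2 =
        ∫ y : ℝ, Complex.I * (y * r y ^ 2) := by
      refine MeasureTheory.integral_congr_ae (Filter.Eventually.of_forall fun y => ?_)
      simp only [hr_def, hu_def]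
      rw [inv_pow, div_eq_mul_inv, mul_assoc]
    rw [h3, hfirst]
    linear_combination (-1 / (6 * Real.pi : ℂ)) * hzero
end

section
/- The sixth moment of the Chernoff density satisfies ∫_ℝ x⁶ f(x) dx = (1/(2πi)) ∫_{−i∞}^{i∞} ((26 − 31z³)/21)/Ai(z)² dz, i.e. it equals (1/(2π)) ∫_ℝ ((26 − 31(iy)³)/21)/Ai(iy)² dy. -/
open Complex ComplexConjugate

lemma le_of_hasDerivAt_nonneg_s17 {F F' : ℝ → ℝ} {a y : ℝ} (h : ∀ x, a ≤ x → HasDerivAt F (F' x) x)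
    (h' : ∀ x, a ≤ x → 0 ≤ F' x) (hy : a ≤ y) : F a ≤ F y := by
  refine monotoneOn_of_deriv_nonneg (convex_Ici a)
    (fun x hx => (h x hx).continuousAt.continuousWithinAt)
    (fun x hx => ?_) (fun x hx => ?_) (Set.self_mem_Ici) hy hy
  · rw [interior_Ici] at hx
    exact (h x hx.le).differentiableAt.differentiableWithinAt
  · rw [interior_Ici] at hx
    rw [(h x hx.le).deriv]
    exact h' x hx.le

lemma HasDerivAt.complex_re {F : ℝ → ℂ} {F' : ℂ} {y : ℝ} (h : HasDerivAt F F' y) :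
    HasDerivAt (fun x => (F x).re) F'.re y :=
  reCLM.hasFDerivAt.comp_hasDerivAt y h

lemma HasDerivAt.complex_im {F : ℝ → ℂ} {F' : ℂ} {y : ℝ} (h : HasDerivAt F F' y) :
    HasDerivAt (fun x => (F x).im) F'.im y :=
  imCLM.hasFDerivAt.comp_hasDerivAt y h

/-- Growth on a half-line of the solutions of `w'' = -i y w` that start like `Ai (i y)`. -/
lemma airy_growth_s17 {w v : ℝ → ℂ} {α β : ℝ} (hα : 0 < α) (hβ : 0 < β)
    (hw : ∀ y, HasDerivAt w (v y) y) (hv : ∀ y : ℝ, HasDerivAt v (-(I * y * w y)) y)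
    (hw0 : w 0 = α) (hv0 : v 0 = -(I * β)) :
    ∃ C : ℝ, 0 ≤ C ∧ ∀ y, 0 ≤ y → ‖v y‖ ≤ C * (1 + y) ^ 5 * ‖w y‖ ∧
      Real.exp y ≤ C * (1 + y) ^ 10 * ‖w y‖ ^ 2 := by
  set r : ℝ → ℝ := fun y => (w y).re ^ 2 + (w y).im ^ 2 with hr
  set p : ℝ → ℝ := fun y => (v y).re ^ 2 + (v y).im ^ 2 with hp
  set c : ℝ → ℝ := fun y => (v y).re * (w y).re + (v y).im * (w y).im with hc
  set σ : ℝ → ℝ := fun y => (v y).re * (w y).im - (v y).im * (w y).re with hσ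
  have dr : ∀ y, HasDerivAt r (2 * c y) y := fun y => by
    refine HasDerivAt.congr_deriv (((hw y).complex_re.pow 2).add ((hw y).complex_im.pow 2)) ?_
    simp [hc]; ring
  have dp : ∀ y, HasDerivAt p (2 * y * σ y) y := fun y => by
    refine HasDerivAt.congr_deriv (((hv y).complex_re.pow 2).add ((hv y).complex_im.pow 2)) ?_
    simp [hσ]; ring
  have dc : ∀ y, HasDerivAt c (p y) y := fun y => by
    refine HasDerivAt.congr_deriv (((hv y).complex_re.mul (hw y).complex_re).add
      ((hv y).complex_im.mul (hw y).complex_im)) ?_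
    simp [hp]; ring
  have dσ : ∀ y, HasDerivAt σ (y * r y) y := fun y => by
    refine HasDerivAt.congr_deriv (((hv y).complex_re.mul (hw y).complex_im).sub
      ((hv y).complex_im.mul (hw y).complex_re)) ?_
    simp [hr]; ring
  have hpr : ∀ y, p y * r y = c y ^ 2 + σ y ^ 2 := fun y => by simp only [hp, hr, hc, hσ]; ring
  have r0 : r 0 = α ^ 2 := by simp [hr, hw0]
  have c0 : c 0 = 0 := by simp [hc, hw0, hv0]
  have σ0 : σ 0 = α * β := by simp [hσ, hw0, hv0]; ring
  have rnn : ∀ y, 0 ≤ r y := fun y => by positivity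
  have pnn : ∀ y, 0 ≤ p y := fun y => by positivity
  have σnn : ∀ y, 0 ≤ y → 0 ≤ σ y := fun y hy => by
    have := le_of_hasDerivAt_nonneg_s17 (fun x _ => dσ x) (fun x hx => mul_nonneg hx (rnn x)) hy
    rw [σ0] at this
    exact le_trans (by positivity) this
  have cnn : ∀ y, 0 ≤ y → 0 ≤ c y := fun y hy => by
    have := le_of_hasDerivAt_nonneg_s17 (fun x _ => dc x) (fun x _ => pnn x) hy
    rwa [c0] at this
  have rge : ∀ y, 0 ≤ y → α ^ 2 ≤ r y := fun y hy => by
    have := le_of_hasDerivAt_nonneg_s17 (fun x _ => dr x)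
      (fun x hx => mul_nonneg zero_le_two (cnn x hx)) hy
    rwa [r0] at this
  have rpos : ∀ y, 0 ≤ y → 0 < r y := fun y hy => lt_of_lt_of_le (by positivity) (rge y hy)
  set M : ℝ := β / α + 1 with hM
  have hM0 : 0 < M := by positivity
  have hMα : α * β ≤ M * α ^ 2 := by
    have : M * α ^ 2 = α * β + α ^ 2 := by rw [hM]; field_simp
    nlinarith [sq_nonneg α]
  have σle : ∀ y, 0 ≤ y → σ y ≤ M * (1 + y) ^ 2 * r y := fun y hy => by
    have d : ∀ x : ℝ, HasDerivAt (fun x => M * (1 + x) ^ 2 * r x - σ x)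
        (2 * M * (1 + x) * r x + M * (1 + x) ^ 2 * (2 * c x) - x * r x) x := fun x => by
      refine HasDerivAt.congr_deriv ((((((hasDerivAt_id x).const_add 1).pow 2).const_mul M).mul (dr x)).sub (dσ x)) ?_
      simp; left; ring
    have := le_of_hasDerivAt_nonneg_s17 (fun x _ => d x) (fun x hx => ?_) hy
    · simp only [r0, σ0] at this
      linarith
    · have h1 : 0 ≤ M * (1 + x) ^ 2 * (2 * c x) := by have := cnn x hx; positivity
      have hM1 : 1 ≤ M := by rw [hM]; linarith [div_pos hβ hα]
      have h2 : x * r x ≤ 2 * M * (1 + x) * r x := by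
        refine mul_le_mul_of_nonneg_right ?_ (rnn x)
        nlinarith
      linarith
  have cle : ∀ y, 0 ≤ y → c y ≤ M ^ 2 * (1 + y) ^ 5 * r y := fun y hy => by
    have d : ∀ x : ℝ, 0 ≤ x → HasDerivAt (fun x => M ^ 2 * (1 + x) ^ 5 - c x / r x)
        (5 * M ^ 2 * (1 + x) ^ 4 - (p x * r x - c x * (2 * c x)) / r x ^ 2) x := fun x hx => by
      refine HasDerivAt.congr_deriv (((((hasDerivAt_id x).const_add 1).pow 5).const_mul (M ^ 2)).sub
        ((dc x).div (dr x) (rpos x hx).ne')) ?_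
      simp; ring
    have := le_of_hasDerivAt_nonneg_s17 d (fun x hx => ?_) hy
    · simp only [c0] at this
      have h2 : 0 ≤ M ^ 2 * (1 + y) ^ 5 - c y / r y :=
        le_trans (by rw [zero_div, sub_zero]; positivity) this
      rw [← div_le_iff₀ (rpos y hy)]
      linarith
    · rw [hpr, sub_nonneg, div_le_iff₀ (by have := rpos x hx; positivity)]
      have h1 : σ x ^ 2 ≤ (M * (1 + x) ^ 2 * r x) ^ 2 := by
        gcongr
        · exact σnn x hx
        · exact σle x hx
      have h2 : 0 ≤ M ^ 2 * (1 + x) ^ 4 * r x ^ 2 := by positivity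
      nlinarith [sq_nonneg (c x)]
  have nw : ∀ y, ‖w y‖ ^ 2 = r y := fun y => by
    rw [Complex.sq_norm, normSq_apply]; simp only [hr]; ring
  have nv : ∀ y, ‖v y‖ ^ 2 = p y := fun y => by
    rw [Complex.sq_norm, normSq_apply]; simp only [hp]; ring
  have one_le : ∀ y : ℝ, 0 ≤ y → 1 ≤ 1 + y := fun y hy => by linarith
  set K : ℝ := M ^ 2 + M with hK
  have hK0 : 0 < K := by positivity
  have cσle : ∀ y, 0 ≤ y → c y + σ y ≤ K * (1 + y) ^ 5 * r y := fun y hy => by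
    have h1 : M * (1 + y) ^ 2 * r y ≤ M * (1 + y) ^ 5 * r y := by
      have := rnn y
      have := one_le y hy
      gcongr
      norm_num
    have := cle y hy
    have := σle y hy
    rw [hK]
    linarith
  have ple : ∀ y, 0 ≤ y → p y ≤ (K * (1 + y) ^ 5) ^ 2 * r y := fun y hy => by
    have h1 : p y * r y ≤ (K * (1 + y) ^ 5 * r y) ^ 2 := by
      have := cnn y hy
      have := σnn y hy
      calc p y * r y ≤ (c y + σ y) ^ 2 := by rw [hpr]; nlinarith [mul_nonneg (cnn y hy) (σnn y hy)]
        _ ≤ _ := by gcongr; exact cσle y hy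
    refine le_of_mul_le_mul_right ?_ (rpos y hy)
    linarith
  have vle : ∀ y, 0 ≤ y → ‖v y‖ ≤ K * (1 + y) ^ 5 * ‖w y‖ := fun y hy => by
    refine le_of_sq_le_sq ?_ (by positivity)
    rw [mul_pow, nv, nw]
    exact ple y hy
  have lexp : ∀ y, 0 ≤ y → α ^ 2 * Real.exp (-1) * Real.exp y ≤ r y + c y + p y + σ y := by
    intro y hy
    rcases le_total y 1 with h | h
    · have h1 : Real.exp (-1) * Real.exp y ≤ 1 := by
        rw [← Real.exp_add, Real.exp_le_one_iff]; linarith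
      have := rge y hy
      have := cnn y hy
      have := σnn y hy
      have := pnn y
      nlinarith [sq_nonneg α]
    · have d : ∀ x : ℝ, HasDerivAt (fun x => (r x + c x + p x + σ x) * Real.exp (-x))
          ((2 * c x + p x + 2 * x * σ x + x * r x) * Real.exp (-x) +
            (r x + c x + p x + σ x) * (Real.exp (-x) * -1)) x := fun x =>
        ((((dr x).add (dc x)).add (dp x)).add (dσ x)).mul (hasDerivAt_neg x).exp
      have := le_of_hasDerivAt_nonneg_s17 (fun x _ => d x) (fun x hx => ?_) h
      · have h1 : α ^ 2 * Real.exp (-1) ≤ (r y + c y + p y + σ y) * Real.exp (-y) := by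
          refine le_trans ?_ this
          gcongr
          linarith [rge 1 zero_le_one, cnn 1 zero_le_one, pnn 1, σnn 1 zero_le_one]
        calc _ ≤ (r y + c y + p y + σ y) * Real.exp (-y) * Real.exp y := by gcongr
          _ = _ := by rw [mul_assoc, ← Real.exp_add]; simp
      · have hx0 : 0 ≤ x := zero_le_one.trans hx
        have h1 : 0 ≤ c x + (2 * x - 1) * σ x + (x - 1) * r x := by
          have h2 := mul_nonneg (by linarith : 0 ≤ 2 * x - 1) (σnn x hx0)
          have h3 := mul_nonneg (by linarith : 0 ≤ x - 1) (rnn x)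
          linarith [cnn x hx0]
        have := mul_nonneg h1 (Real.exp_nonneg (-x))
        linarith
  have rexp : ∀ y, 0 ≤ y → α ^ 2 * Real.exp (-1) * Real.exp y ≤
      (1 + K + K ^ 2) * (1 + y) ^ 10 * r y := fun y hy => by
    refine (lexp y hy).trans ?_
    have h1 : 1 * r y ≤ (1 + y) ^ 10 * r y := by
      have := rnn y
      gcongr
      exact one_le_pow₀ (one_le y hy)
    have h2 : K * (1 + y) ^ 5 * r y ≤ K * (1 + y) ^ 10 * r y := by
      have := rnn y
      have := one_le y hy
      gcongr
      norm_num
    have := cσle y hy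
    have := ple y hy
    linarith
  have hA : 0 < α ^ 2 * Real.exp (-1) := by positivity
  refine ⟨max K ((1 + K + K ^ 2) / (α ^ 2 * Real.exp (-1))), by positivity, fun y hy => ⟨?_, ?_⟩⟩
  · refine (vle y hy).trans ?_
    gcongr
    exact le_max_left _ _
  · rw [nw]
    have h1 : Real.exp y ≤ (1 + K + K ^ 2) / (α ^ 2 * Real.exp (-1)) * (1 + y) ^ 10 * r y := by
      rw [div_mul_eq_mul_div, div_mul_eq_mul_div, le_div_iff₀ hA]
      linarith [rexp y hy]
    refine h1.trans ?_
    have := rnn y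
    gcongr
    exact le_max_right _ _

/-- The functions `ℝ → ℂ` that are polynomials in the variable and in `G`. -/
inductive IsPolyIn (G : ℝ → ℂ) : (ℝ → ℂ) → Prop
  | const (c : ℂ) : IsPolyIn G fun _ => c
  | var : IsPolyIn G fun y => (y : ℂ)
  | gen : IsPolyIn G fun y => G y
  | add {a b : ℝ → ℂ} : IsPolyIn G a → IsPolyIn G b → IsPolyIn G fun y => a y + b y
  | mul {a b : ℝ → ℂ} : IsPolyIn G a → IsPolyIn G b → IsPolyIn G fun y => a y * b y

namespace IsPolyIn

variable {G u a b : ℝ → ℂ} {C : ℝ}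

lemma pow (h : IsPolyIn G a) (n : ℕ) : IsPolyIn G fun y => a y ^ n := by
  induction n with
  | zero => simpa using const (G := G) 1
  | succ n ih => simpa only [pow_succ] using ih.mul h

lemma exists_hasDerivAt (hG : ∀ y : ℝ, HasDerivAt G (I * (I * y - G y ^ 2)) y)
    (h : IsPolyIn G a) : ∃ b, IsPolyIn G b ∧ ∀ y, HasDerivAt a (b y) y := by
  induction h with
  | const c => exact ⟨_, const 0, fun y => hasDerivAt_const y c⟩
  | var => exact ⟨_, const 1, fun y => ofRealCLM.hasDerivAt⟩
  | gen =>
    refine ⟨_, (const I).mul (((const I).mul var).add ((const (-1)).mul (gen.pow 2))),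
      fun y => (hG y).congr_deriv ?_⟩
    ring
  | add _ _ iha ihb =>
    obtain ⟨a', ha', da⟩ := iha
    obtain ⟨b', hb', db⟩ := ihb
    exact ⟨_, ha'.add hb', fun y => (da y).add (db y)⟩
  | mul ha hb iha ihb =>
    obtain ⟨a', ha', da⟩ := iha
    obtain ⟨b', hb', db⟩ := ihb
    exact ⟨_, (ha'.mul hb).add (ha.mul hb'), fun y => (da y).mul (db y)⟩

lemma exists_norm_le (hC : 0 ≤ C) (hGb : ∀ y, ‖G y‖ ≤ C * (1 + |y|) ^ 5) (h : IsPolyIn G a) :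
    ∃ (D : ℝ) (k : ℕ), 0 ≤ D ∧ ∀ y, ‖a y‖ ≤ D * (1 + |y|) ^ k := by
  have one_le (y : ℝ) : 1 ≤ 1 + |y| := by linarith [abs_nonneg y]
  induction h with
  | const c => exact ⟨‖c‖, 0, norm_nonneg c, fun y => by simp⟩
  | var => exact ⟨1, 1, zero_le_one, fun y => by simp⟩
  | gen => exact ⟨C, 5, hC, hGb⟩
  | add _ _ iha ihb =>
    obtain ⟨D, k, hD, h1⟩ := iha
    obtain ⟨E, l, hE, h2⟩ := ihb
    refine ⟨D + E, k + l, by positivity, fun y => (norm_add_le _ _).trans ?_⟩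
    rw [add_mul]
    refine add_le_add ((h1 y).trans ?_) ((h2 y).trans ?_)
    · gcongr
      · exact one_le y
      · lia
    · gcongr
      · exact one_le y
      · lia
  | mul _ _ iha ihb =>
    obtain ⟨D, k, hD, h1⟩ := iha
    obtain ⟨E, l, hE, h2⟩ := ihb
    refine ⟨D * E, k + l, by positivity, fun y => ?_⟩
    rw [norm_mul, pow_add, mul_mul_mul_comm]
    exact mul_le_mul (h1 y) (h2 y) (norm_nonneg _) ((norm_nonneg _).trans (h1 y))

lemma hasDerivAt_mul (hu : ∀ y : ℝ, HasDerivAt u (-(I * G y * u y)) y)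
    (da : ∀ y, HasDerivAt a (b y) y) (y : ℝ) :
    HasDerivAt (fun y => a y * u y) ((b y + -I * G y * a y) * u y) y :=
  ((da y).mul (hu y)).congr_deriv (by ring)

lemma exists_iteratedDeriv_mul (hG : ∀ y : ℝ, HasDerivAt G (I * (I * y - G y ^ 2)) y)
    (hu : ∀ y : ℝ, HasDerivAt u (-(I * G y * u y)) y) (h : IsPolyIn G a) (n : ℕ) :
    ∃ b, IsPolyIn G b ∧ iteratedDeriv n (fun y => a y * u y) = fun y => b y * u y := by
  induction n with
  | zero => exact ⟨a, h, iteratedDeriv_zero⟩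
  | succ n ih =>
    obtain ⟨b, hb, e⟩ := ih
    obtain ⟨b', hb', db⟩ := hb.exists_hasDerivAt hG
    refine ⟨_, hb'.add (((const (-I)).mul gen).mul hb), ?_⟩
    rw [iteratedDeriv_succ, e]
    exact funext fun y => (hasDerivAt_mul hu db y).deriv

lemma exists_pow_mul_norm_le (hC : 0 ≤ C) (hGb : ∀ y, ‖G y‖ ≤ C * (1 + |y|) ^ 5)
    (hub : ∀ y, ‖u y‖ ^ 2 * Real.exp |y| ≤ C * (1 + |y|) ^ 10) (h : IsPolyIn G a) (n : ℕ) :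
    ∃ D : ℝ, ∀ y, |y| ^ n * ‖a y * u y‖ ≤ D := by
  obtain ⟨D, k, hD, hb⟩ := h.exists_norm_le hC hGb
  set m := 2 * n + 2 * k + 10
  refine ⟨√(D ^ 2 * C * (m.factorial * Real.exp 1)), fun y => Real.le_sqrt_of_sq_le ?_⟩
  have hpow : (1 + |y|) ^ m ≤ m.factorial * Real.exp 1 * Real.exp |y| := by
    rw [mul_assoc, ← Real.exp_add, ← div_le_iff₀' (by positivity)]
    exact Real.pow_div_factorial_le_exp _ (by positivity) m
  refine le_of_mul_le_mul_right ?_ (Real.exp_pos |y|)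
  calc (|y| ^ n * ‖a y * u y‖) ^ 2 * Real.exp |y|
      = (|y| ^ n * ‖a y‖) ^ 2 * (‖u y‖ ^ 2 * Real.exp |y|) := by rw [norm_mul]; ring
    _ ≤ ((1 + |y|) ^ n * (D * (1 + |y|) ^ k)) ^ 2 * (C * (1 + |y|) ^ 10) := by
        refine mul_le_mul ?_ (hub y) (by positivity) (by positivity)
        gcongr
        · linarith
        · exact hb y
    _ = D ^ 2 * C * (1 + |y|) ^ m := by ring
    _ ≤ D ^ 2 * C * (m.factorial * Real.exp 1 * Real.exp |y|) := by gcongr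
    _ = _ := by ring

lemma exists_schwartzMap (hG : ∀ y : ℝ, HasDerivAt G (I * (I * y - G y ^ 2)) y)
    (hu : ∀ y : ℝ, HasDerivAt u (-(I * G y * u y)) y)
    (hC : 0 ≤ C) (hGb : ∀ y, ‖G y‖ ≤ C * (1 + |y|) ^ 5)
    (hub : ∀ y, ‖u y‖ ^ 2 * Real.exp |y| ≤ C * (1 + |y|) ^ 10) (h : IsPolyIn G a) :
    ∃ s : SchwartzMap ℝ ℂ, ∀ y, s y = a y * u y := by
  refine ⟨⟨fun y => a y * u y, ?_, fun k n => ?_⟩, fun y => rfl⟩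
  · refine contDiff_of_differentiable_iteratedDeriv (n := ⊤) fun m _ => ?_
    obtain ⟨b, hb, e⟩ := h.exists_iteratedDeriv_mul hG hu m
    obtain ⟨b', -, db⟩ := hb.exists_hasDerivAt hG
    rw [e]
    exact fun y => (hasDerivAt_mul hu db y).differentiableAt
  · obtain ⟨b, hb, e⟩ := h.exists_iteratedDeriv_mul hG hu n
    simp_rw [norm_iteratedFDeriv_eq_norm_iteratedDeriv, e]
    exact hb.exists_pow_mul_norm_le hC hGb hub k

lemma integrable_mul_sq (hG : ∀ y : ℝ, HasDerivAt G (I * (I * y - G y ^ 2)) y)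
    (hu : ∀ y : ℝ, HasDerivAt u (-(I * G y * u y)) y)
    (hC : 0 ≤ C) (hGb : ∀ y, ‖G y‖ ≤ C * (1 + |y|) ^ 5)
    (hub : ∀ y, ‖u y‖ ^ 2 * Real.exp |y| ≤ C * (1 + |y|) ^ 10) (h : IsPolyIn G a) :
    MeasureTheory.Integrable fun y => a y * u y ^ 2 := by
  obtain ⟨s, hs⟩ := h.exists_schwartzMap hG hu hC hGb hub
  obtain ⟨D, hD⟩ := (const (G := G) 1).exists_pow_mul_norm_le hC hGb hub 0
  have hu' : Continuous u := continuous_iff_continuousAt.2 fun y => (hu y).continuousAt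
  refine (s.integrable.bdd_mul (f := u) (c := D) hu'.aestronglyMeasurable
    (.of_forall fun y => by simpa using hD y)).congr (.of_forall fun y => ?_)
  simp only [hs]
  ring

lemma integral_deriv_mul_sq (hG : ∀ y : ℝ, HasDerivAt G (I * (I * y - G y ^ 2)) y)
    (hu : ∀ y : ℝ, HasDerivAt u (-(I * G y * u y)) y)
    (hC : 0 ≤ C) (hGb : ∀ y, ‖G y‖ ≤ C * (1 + |y|) ^ 5)
    (hub : ∀ y, ‖u y‖ ^ 2 * Real.exp |y| ≤ C * (1 + |y|) ^ 10)
    (ha : IsPolyIn G a) (hb : IsPolyIn G b) (da : ∀ y, HasDerivAt a (b y) y) :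
    ∫ y, (b y + -2 * I * G y * a y) * u y ^ 2 = 0 :=
  MeasureTheory.integral_eq_zero_of_hasDerivAt_of_integrable
    (fun y => ((da y).mul ((hu y).pow 2)).congr_deriv (by simp; ring))
    ((hb.add (((const (-2 * I)).mul gen).mul ha)).integrable_mul_sq hG hu hC hGb hub)
    (ha.integrable_mul_sq hG hu hC hGb hub)

/-- The third derivative of `u` squared, reduced by integration by parts. -/
lemma integral_sq_eq (hG : ∀ y : ℝ, HasDerivAt G (I * (I * y - G y ^ 2)) y)
    (hu : ∀ y : ℝ, HasDerivAt u (-(I * G y * u y)) y)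
    (hC : 0 ≤ C) (hGb : ∀ y, ‖G y‖ ≤ C * (1 + |y|) ^ 5)
    (hub : ∀ y, ‖u y‖ ^ 2 * Real.exp |y| ≤ C * (1 + |y|) ^ 10) :
    ∫ y : ℝ, (-I * (-1 + 5 * (I * y) * G y - 6 * G y ^ 3) * u y) ^ 2 =
      ∫ y : ℝ, ((26 - 31 * (I * y) ^ 3) / 21) * u y ^ 2 := by
  have hz : IsPolyIn G fun y => I * (y : ℂ) := (const I).mul var
  have hp : IsPolyIn G fun y : ℝ => 36 / 7 * G y ^ 5 + -48 / 7 * ((I * y) * G y ^ 3) +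
      31 / 21 * ((I * y) ^ 2 * G y) + 9 / 7 * G y ^ 2 + -47 / 21 * (I * y) :=
    (((((const _).mul (gen.pow 5)).add ((const _).mul (hz.mul (gen.pow 3)))).add
      ((const _).mul ((hz.pow 2).mul gen))).add ((const _).mul (gen.pow 2))).add
      ((const _).mul hz)
  obtain ⟨b, hb, db⟩ := hp.exists_hasDerivAt hG
  have hb_eq (y : ℝ) : b y = I * (-48 / 7 * G y ^ 3 + 62 / 21 * (I * y) * G y - 47 / 21 +
      (180 / 7 * G y ^ 4 - 144 / 7 * (I * y) * G y ^ 2 + 31 / 21 * (I * y) ^ 2 + 18 / 7 * G y) *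
        (I * y - G y ^ 2)) := by
    have dz : HasDerivAt (fun y : ℝ => I * (y : ℂ)) I y :=
      ((ofRealCLM.hasDerivAt (x := y)).const_mul I).congr_deriv (by simp)
    have dG := hG y
    refine (db y).unique <| ((((((dG.pow 5).const_mul _).add
      ((dz.mul (dG.pow 3)).const_mul _)).add (((dz.pow 2).mul dG).const_mul _)).add
      ((dG.pow 2).const_mul _)).add (dz.const_mul _)).congr_deriv ?_
    simp
    ring
  have h0 := integral_deriv_mul_sq hG hu hC hGb hub hp hb db
  have hT : MeasureTheory.Integrable fun y : ℝ => ((26 - 31 * (I * y) ^ 3) / 21) * u y ^ 2 :=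
    (((const (26 / 21)).add ((const (-31 / 21)).mul (hz.pow 3))).integrable_mul_sq
      hG hu hC hGb hub).congr (.of_forall fun y => by ring)
  have hI := (hb.add (((const (-2 * I)).mul gen).mul hp)).integrable_mul_sq hG hu hC hGb hub
  calc _ = ∫ y : ℝ, ((26 - 31 * (I * y) ^ 3) / 21) * u y ^ 2 +
        -I * ((b y + -2 * I * G y * (36 / 7 * G y ^ 5 + -48 / 7 * ((I * y) * G y ^ 3) +
      31 / 21 * ((I * y) ^ 2 * G y) + 9 / 7 * G y ^ 2 + -47 / 21 * (I * y))) * u y ^ 2) := by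
        congr 1 with y
        rw [hb_eq]
        generalize hzz : I * (y : ℂ) = z
        linear_combination (u y ^ 2 * ((-1 + 5 * z * G y - 6 * G y ^ 3) ^ 2 +
          (-48 / 7 * G y ^ 3 + 62 / 21 * z * G y - 47 / 21 +
            (180 / 7 * G y ^ 4 - 144 / 7 * z * G y ^ 2 + 31 / 21 * z ^ 2 + 18 / 7 * G y) *
              (z - G y ^ 2)) - 2 * G y * (36 / 7 * G y ^ 5 + -48 / 7 * (z * G y ^ 3) +
            31 / 21 * (z ^ 2 * G y) + 9 / 7 * G y ^ 2 + -47 / 21 * z))) * I_sq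
    _ = _ := by
        rw [MeasureTheory.integral_add hT (hI.const_mul _), MeasureTheory.integral_const_mul, h0]
        simp

end IsPolyIn

open FourierTransform in
/-- Parseval's identity for `x ^ 3 * 𝓕 s x`, in the angular-frequency normalization. -/
lemma integral_pow_six_mul_fourier (s : SchwartzMap ℝ ℂ) :
    ∫ x : ℝ, (x : ℂ) ^ 6 * ((∫ t : ℝ, exp (-(I * t * x)) * s t) *
      ∫ t : ℝ, exp (-(I * t * (-x : ℝ))) * s t) =
    2 * Real.pi * ∫ y, iteratedDeriv 3 s y ^ 2 := by
  have hd (r : SchwartzMap ℝ ℂ) (x : ℝ) : 𝓕 (SchwartzMap.derivCLM ℂ ℂ r) x =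
      (2 * Real.pi * I * x) * 𝓕 r x := by
    have h1 : (SchwartzMap.derivCLM ℂ ℂ r : ℝ → ℂ) = deriv r := funext fun y => rfl
    rw [SchwartzMap.fourier_coe, SchwartzMap.fourier_coe, h1,
      Real.fourier_deriv r.integrable r.differentiable (h1 ▸ SchwartzMap.integrable _)]
    rfl
  set D := SchwartzMap.derivCLM ℂ ℂ (SchwartzMap.derivCLM ℂ ℂ (SchwartzMap.derivCLM ℂ ℂ s)) with hD
  have hD3 (x : ℝ) : 𝓕 D x = (2 * Real.pi * I * x) ^ 3 * 𝓕 s x := by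
    rw [hD, hd, hd, hd]
    ring
  have hDi : (D : ℝ → ℂ) = iteratedDeriv 3 s := by
    rw [iteratedDeriv_succ, iteratedDeriv_succ, iteratedDeriv_one]
    rfl
  have hF (x : ℝ) : ∫ t : ℝ, exp (-(I * t * ((2 * Real.pi * x : ℝ) : ℂ))) * s t = 𝓕 s x := by
    rw [SchwartzMap.fourier_coe, Real.fourier_real_eq_integral_exp_smul]
    congr 1 with t
    rw [smul_eq_mul]
    congr 2
    push_cast
    ring
  have hinv (x : ℝ) : 𝓕⁻ D x = 𝓕 D (-x) := by
    rw [SchwartzMap.fourierInv_coe, SchwartzMap.fourier_coe, Real.fourierInv_eq_fourier_neg]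
  have hpi0 : (2 * Real.pi : ℝ) ≠ 0 := by positivity
  have hcv := MeasureTheory.Measure.integral_comp_mul_left (fun x : ℝ => (x : ℂ) ^ 6 *
    ((∫ t : ℝ, exp (-(I * t * x)) * s t) * ∫ t : ℝ, exp (-(I * t * (-x : ℝ))) * s t))
    (2 * Real.pi)
  rw [eq_comm, abs_of_pos (by positivity), inv_smul_eq_iff₀ hpi0] at hcv
  rw [hcv]
  have hpar := SchwartzMap.integral_fourier_mul_eq D (𝓕⁻ D)
  rw [FourierTransform.fourier_fourierInv_eq] at hpar
  rw [real_smul, ← hDi]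
  simp_rw [pow_two (D _)]
  rw [← hpar]
  push_cast
  congr 2 with x
  have hF' := hF (-x)
  rw [mul_neg] at hF'
  have hFx := hF x
  push_cast at hF' hFx
  rw [hFx, hF', hinv, hD3, hD3]
  push_cast
  linear_combination (2 * Real.pi * x) ^ 6 * 𝓕 s x * 𝓕 s (-x) * (I ^ 4 - I ^ 2 + 1) * I_sq

lemma airy_initial_value_pos : ∃ α : ℝ, 0 < α ∧
    (3 : ℂ) ^ (-(2 : ℂ) / 3) / Complex.Gamma (2 / 3) = α := by
  refine ⟨3 ^ (-(2 : ℝ) / 3) / Real.Gamma (2 / 3),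
    div_pos (by positivity) (Real.Gamma_pos_of_pos (by norm_num)), ?_⟩
  rw [ofReal_div, ofReal_cpow (by norm_num), ← Complex.Gamma_ofReal]
  push_cast
  rfl

lemma airy_initial_slope_neg : ∃ β : ℝ, 0 < β ∧
    -(3 : ℂ) ^ (-(1 : ℂ) / 3) / Complex.Gamma (1 / 3) = -β := by
  refine ⟨3 ^ (-(1 : ℝ) / 3) / Real.Gamma (1 / 3),
    div_pos (by positivity) (Real.Gamma_pos_of_pos (by norm_num)), ?_⟩
  rw [ofReal_div, ofReal_cpow (by norm_num), ← Complex.Gamma_ofReal]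
  push_cast
  rw [neg_div]

lemma airy_imaginary_bounds {Ai : ℂ → ℂ} {α β : ℝ} (hα : 0 < α) (hβ : 0 < β)
    (h1 : Differentiable ℂ Ai) (h2 : Differentiable ℂ (deriv Ai))
    (hode : ∀ z : ℂ, deriv (deriv Ai) z = z * Ai z) (h0 : Ai 0 = α) (h0' : deriv Ai 0 = -β) :
    ∃ C : ℝ, 0 ≤ C ∧ ∀ y : ℝ, ‖deriv Ai (I * y)‖ ≤ C * (1 + |y|) ^ 5 * ‖Ai (I * y)‖ ∧
      Real.exp |y| ≤ C * (1 + |y|) ^ 10 * ‖Ai (I * y)‖ ^ 2 := by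
  have hline (c : ℂ) (y : ℝ) : HasDerivAt (fun x : ℝ => c * (x : ℂ)) c y :=
    ((ofRealCLM.hasDerivAt (x := y)).const_mul c).congr_deriv (by simp)
  have hd (c : ℂ) (y : ℝ) : HasDerivAt (fun x : ℝ => Ai (c * x)) (c * deriv Ai (c * y)) y :=
    ((h1 (c * y)).hasDerivAt.comp y (hline c y)).congr_deriv (by ring)
  have hd' (c : ℂ) (y : ℝ) : HasDerivAt (fun x : ℝ => c * deriv Ai (c * x))
      (c ^ 3 * y * Ai (c * y)) y :=
    ((HasDerivAt.comp (h₂ := deriv Ai) y (h2 (c * y)).hasDerivAt (hline c y)).const_mul c).congr_deriv (by rw [hode]; ring)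
  have hconj {F : ℝ → ℂ} {F' : ℂ} {y : ℝ} (h : HasDerivAt F F' y) :
      HasDerivAt (fun x => conj (F x)) (conj F') y :=
    conjCLE.toContinuousLinearMap.hasFDerivAt.comp_hasDerivAt y h
  have hI3 : I ^ 3 = -I := by rw [pow_succ, I_sq]; ring
  obtain ⟨C, hC, hb⟩ := airy_growth_s17 hα hβ (hd I)
    (fun y => (hd' I y).congr_deriv (by rw [hI3]; ring)) (by simp [h0]) (by simp [h0'])
  obtain ⟨C', -, hb'⟩ := airy_growth_s17 hα hβ (fun y => hconj (hd (-I) y))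
    (fun y => (hconj (hd' (-I) y)).congr_deriv (by simp [Odd.neg_pow (show Odd 3 by decide), hI3]))
    (by simp [h0]) (by simp [h0'])
  refine ⟨max C C', le_max_of_le_left hC, fun y => ?_⟩
  have key : ∃ E ≤ max C C', ‖deriv Ai (I * y)‖ ≤ E * (1 + |y|) ^ 5 * ‖Ai (I * y)‖ ∧
      Real.exp |y| ≤ E * (1 + |y|) ^ 10 * ‖Ai (I * y)‖ ^ 2 := by
    rcases le_total 0 y with hy | hy
    · refine ⟨C, le_max_left _ _, ?_⟩
      rw [abs_of_nonneg hy]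
      simpa using hb y hy
    · refine ⟨C', le_max_right _ _, ?_⟩
      rw [abs_of_nonpos hy]
      simpa using hb' (-y) (neg_nonneg.2 hy)
  obtain ⟨E, hE, h3, h4⟩ := key
  exact ⟨h3.trans (by gcongr), h4.trans (by gcongr)⟩

theorem chernoff_sixth_moment (Ai : ℂ → ℂ)
    (hAi_d1 : Differentiable ℂ Ai)
    (hAi_d2 : Differentiable ℂ (deriv Ai))
    (hAi_ode : ∀ z : ℂ, deriv (deriv Ai) z = z * Ai z)
    (hAi_0 : Ai 0 = (3 : ℂ) ^ (-(2 : ℂ) / 3) / Complex.Gamma (2 / 3))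
    (hAi_0' : deriv Ai 0 = -(3 : ℂ) ^ (-(1 : ℂ) / 3) / Complex.Gamma (1 / 3))
    (hAi_zeros : ∀ z : ℂ, Ai z = 0 → ∃ x : ℝ, x < 0 ∧ z = (x : ℂ))
    (g : ℝ → ℝ)
    (hg : ∀ x : ℝ, (g x : ℂ) =
      (1 / (2 * (Real.pi : ℂ))) *
        ∫ t : ℝ, Complex.exp (-(Complex.I * t * x)) * ((Real.sqrt 2 : ℂ) / Ai (Complex.I * t)))
    (f : ℝ → ℝ)
    (hf : ∀ x : ℝ, f x = (1 / 2) * g x * g (-x)) :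
    ((∫ x : ℝ, x ^ 6 * f x : ℝ) : ℂ) =
      (1 / (2 * (Real.pi : ℂ))) *
        ∫ y : ℝ, ((26 - 31 * (Complex.I * y) ^ 3) / 21) / (Ai (Complex.I * y)) ^ 2 := by
  obtain ⟨α, hα, h0⟩ := airy_initial_value_pos
  obtain ⟨β, hβ, h0'⟩ := airy_initial_slope_neg
  obtain ⟨C, hC, hb⟩ := airy_imaginary_bounds hα hβ hAi_d1 hAi_d2 hAi_ode (hAi_0.trans h0)
    (hAi_0'.trans h0')
  have hne (y : ℝ) : Ai (I * y) ≠ 0 := fun h => by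
    have := (hb y).2
    rw [h] at this
    simp only [norm_zero, ne_eq, OfNat.ofNat_ne_zero, not_false_eq_true, zero_pow, mul_zero] at this
    exact this.not_gt (Real.exp_pos _)
  set u : ℝ → ℂ := fun y => (Ai (I * y))⁻¹ with hu_def
  set G : ℝ → ℂ := fun y => deriv Ai (I * y) / Ai (I * y) with hG_def
  have hline (y : ℝ) : HasDerivAt (fun x : ℝ => I * (x : ℂ)) I y :=
    ((ofRealCLM.hasDerivAt (x := y)).const_mul I).congr_deriv (by simp)
  have dA (y : ℝ) : HasDerivAt (fun x : ℝ => Ai (I * x)) (I * deriv Ai (I * y)) y :=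
    ((hAi_d1 (I * y)).hasDerivAt.comp y (hline y)).congr_deriv (by ring)
  have dA' (y : ℝ) : HasDerivAt (fun x : ℝ => deriv Ai (I * x)) (I * (I * y * Ai (I * y))) y :=
    (HasDerivAt.comp (h₂ := deriv Ai) y (hAi_d2 (I * y)).hasDerivAt (hline y)).congr_deriv (by rw [hAi_ode]; ring)
  have hu (y : ℝ) : HasDerivAt u (-(I * G y * u y)) y :=
    ((dA y).inv (hne y)).congr_deriv (by have := hne y; simp only [hu_def, hG_def]; field_simp)
  have hG (y : ℝ) : HasDerivAt G (I * (I * y - G y ^ 2)) y :=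
    ((dA' y).div (dA y) (hne y)).congr_deriv
      (by have := hne y; simp only [hG_def]; field_simp)
  have hGb (y : ℝ) : ‖G y‖ ≤ C * (1 + |y|) ^ 5 := by
    rw [norm_div, div_le_iff₀ (norm_pos_iff.2 (hne y))]
    exact (hb y).1
  have hub (y : ℝ) : ‖u y‖ ^ 2 * Real.exp |y| ≤ C * (1 + |y|) ^ 10 := by
    have := norm_pos_iff.2 (hne y)
    rw [norm_inv, inv_pow, inv_mul_le_iff₀ (by positivity)]
    linarith [(hb y).2]
  obtain ⟨s, hs⟩ := (IsPolyIn.const (G := G) 1).exists_schwartzMap hG hu hC hGb hub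
  have hsu : (s : ℝ → ℂ) = u := funext fun y => by rw [hs, one_mul]
  have hs3 : iteratedDeriv 3 s = fun y : ℝ =>
      -I * (-1 + 5 * (I * y) * G y - 6 * G y ^ 3) * u y := by
    rw [hsu, iteratedDeriv_succ, iteratedDeriv_succ, iteratedDeriv_one]
    have e1 : deriv u = fun y => (-I * G y) * u y := funext fun y => by rw [(hu y).deriv]; ring
    have e2 : deriv (fun y => (-I * G y) * u y) =
        fun y : ℝ => (I * y - 2 * G y ^ 2) * u y := funext fun y => by
      refine HasDerivAt.deriv ((((hG y).const_mul (-I)).mul (hu y)).congr_deriv ?_)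
      linear_combination (-(I * y) + 2 * G y ^ 2) * u y * I_sq
    have e3 : deriv (fun y : ℝ => (I * y - 2 * G y ^ 2) * u y) = fun y : ℝ =>
        -I * (-1 + 5 * (I * y) * G y - 6 * G y ^ 3) * u y := funext fun y => by
      refine HasDerivAt.deriv ((((hline y).sub (((hG y).pow 2).const_mul 2)).mul
        (hu y)).congr_deriv ?_)
      simp
      ring
    rw [e1, e2, e3]
  have hg' (x : ℝ) : (g x : ℂ) = Real.sqrt 2 / (2 * Real.pi) *
      ∫ t : ℝ, exp (-(I * t * x)) * s t := by
    rw [hg, div_mul_eq_mul_div, div_mul_eq_mul_div, one_mul, ← MeasureTheory.integral_const_mul]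
    congr 2 with t
    rw [hsu]
    simp only [hu_def]
    ring
  have hsq : (Real.sqrt 2 : ℂ) ^ 2 = 2 := by
    rw [← ofReal_pow, Real.sq_sqrt zero_le_two, ofReal_ofNat]
  have hfx (x : ℝ) : ((x ^ 6 * f x : ℝ) : ℂ) = 1 / (2 * Real.pi) ^ 2 * ((x : ℂ) ^ 6 *
      ((∫ t : ℝ, exp (-(I * t * x)) * s t) * ∫ t : ℝ, exp (-(I * t * (-x : ℝ))) * s t)) := by
    rw [hf]
    push_cast [hg']
    field_simp
    rw [hsq]
  rw [← integral_complex_ofReal]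
  simp_rw [hfx]
  rw [MeasureTheory.integral_const_mul, integral_pow_six_mul_fourier, hs3,
    IsPolyIn.integral_sq_eq hG hu hC hGb hub]
  simp only [hu_def, inv_pow, ← div_eq_mul_inv]
  field_simp
end

section
/- For every even positive integer n there exists a polynomial p_n with rational coefficients and degree at most n/2 such that the n-th moment of the Chernoff density satisfies ∫_ℝ x^n f(x) dx = (1/(2πi)) ∫_{−i∞}^{i∞} p_n(z)/Ai(z)² dz = (1/(2π)) ∫_ℝ p_n(iy)/Ai(iy)² dy. -/
theorem nonneg_of_hasDerivAt_nonneg {F F' : ℝ → ℝ} (hF : ∀ t, HasDerivAt F (F' t) t)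
    (hF' : ∀ t, 0 ≤ t → 0 ≤ F' t) (h0 : 0 ≤ F 0) {t : ℝ} (ht : 0 ≤ t) : 0 ≤ F t := by
  have hmono : MonotoneOn F (Set.Ici 0) := by
    refine monotoneOn_of_deriv_nonneg (convex_Ici 0)
      (fun x _ => (hF x).continuousAt.continuousWithinAt)
      (fun x _ => (hF x).differentiableAt.differentiableWithinAt) fun x hx => ?_
    rw [interior_Ici] at hx
    rw [(hF x).deriv]
    exact hF' x (le_of_lt hx)
  exact h0.trans (hmono Set.self_mem_Ici ht ht)

theorem mul_pow_succ_le_of_hasDerivAt {F F' : ℝ → ℝ} (hF : ∀ t, HasDerivAt F (F' t) t) {c : ℝ}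
    {m : ℕ} (hF' : ∀ t, 0 ≤ t → c * t ^ m ≤ F' t) (h0 : 0 ≤ F 0) {t : ℝ} (ht : 0 ≤ t) :
    c / (m + 1) * t ^ (m + 1) ≤ F t := by
  have hd : ∀ s, HasDerivAt (fun s => F s - c / (m + 1) * s ^ (m + 1)) (F' s - c * s ^ m) s := by
    intro s
    refine HasDerivAt.congr_deriv
      ((hF s).sub ((hasDerivAt_pow (m + 1) s).const_mul (c / (m + 1)))) ?_
    have : (m : ℝ) + 1 ≠ 0 := by positivity
    push_cast
    field_simp
  have := nonneg_of_hasDerivAt_nonneg hd (fun s hs => sub_nonneg.2 (hF' s hs)) (by simpa using h0) ht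
  linarith

/-- Growth on `[0, ∞)` of a solution `p + i q` of the Airy equation along the imaginary axis. -/
theorem airy_ray_real {p q p₁ q₁ : ℝ → ℝ} (hp : ∀ t, HasDerivAt p (p₁ t) t)
    (hq : ∀ t, HasDerivAt q (q₁ t) t) (hp₁ : ∀ t, HasDerivAt p₁ (t * q t) t)
    (hq₁ : ∀ t, HasDerivAt q₁ (-(t * p t)) t) {A B : ℝ} (hA : 0 < A) (hB : 0 ≤ B)
    (hp0 : p 0 = A) (hq0 : q 0 = 0) (hp₁0 : p₁ 0 = 0) (hq₁0 : q₁ 0 = -B) :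
    (∀ t, 0 ≤ t → A ^ 2 ≤ p t ^ 2 + q t ^ 2) ∧
    (∀ t, 0 ≤ t → p₁ t ^ 2 + q₁ t ^ 2 ≤ (B / A + t ^ 2 / 2) ^ 2 * (p t ^ 2 + q t ^ 2)) ∧
    ∀ k : ℕ, ∃ c : ℝ, 0 < c ∧ ∀ t, 0 ≤ t → c * t ^ (6 * k) ≤ p t ^ 2 + q t ^ 2 := by
  set R : ℝ → ℝ := fun t => p t ^ 2 + q t ^ 2 with hR
  set R₁ : ℝ → ℝ := fun t => 2 * (p t * p₁ t + q t * q₁ t) with hR₁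
  set R₂ : ℝ → ℝ := fun t => 2 * (p₁ t ^ 2 + q₁ t ^ 2) with hR₂
  set L : ℝ → ℝ := fun t => q t * p₁ t - p t * q₁ t with hL
  have dR : ∀ t, HasDerivAt R (R₁ t) t := fun t => by
    refine HasDerivAt.congr_deriv (((hp t).pow 2).add ((hq t).pow 2)) ?_
    simp only [hR₁]; push_cast; ring
  have dR₁ : ∀ t, HasDerivAt R₁ (R₂ t) t := fun t => by
    refine HasDerivAt.congr_deriv ((((hp t).mul (hp₁ t)).add ((hq t).mul (hq₁ t))).const_mul 2) ?_
    simp only [hR₂]; ring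
  have dR₂ : ∀ t, HasDerivAt R₂ (4 * t * L t) t := fun t => by
    refine HasDerivAt.congr_deriv ((((hp₁ t).pow 2).add ((hq₁ t).pow 2)).const_mul 2) ?_
    simp only [hL]; push_cast; ring
  have dL : ∀ t, HasDerivAt L (t * R t) t := fun t => by
    refine HasDerivAt.congr_deriv (((hq t).mul (hp₁ t)).sub ((hp t).mul (hq₁ t))) ?_
    simp only [hR]; ring
  have R0 : R 0 = A ^ 2 := by simp [hR, hp0, hq0]
  have R₁0 : R₁ 0 = 0 := by simp [hR₁, hp₁0, hq0]
  have R₂0 : R₂ 0 = 2 * B ^ 2 := by simp [hR₂, hp₁0, hq₁0]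
  have L0 : L 0 = A * B := by simp [hL, hp0, hq0, hq₁0]
  have R_nn : ∀ t, 0 ≤ R t := fun t => by positivity
  have R₂_nn : ∀ t, 0 ≤ R₂ t := fun t => by positivity
  have R₁_nn : ∀ t, 0 ≤ t → 0 ≤ R₁ t := fun t =>
    nonneg_of_hasDerivAt_nonneg dR₁ (fun s _ => R₂_nn s) R₁0.ge
  have R_ge : ∀ t, 0 ≤ t → A ^ 2 ≤ R t := fun t ht => by
    have := nonneg_of_hasDerivAt_nonneg (fun s => (dR s).sub_const (A ^ 2)) R₁_nn
      (by simp [R0]) ht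
    linarith
  have L_le : ∀ t, 0 ≤ t → L t ≤ (B / A + t ^ 2 / 2) * R t := fun t ht => by
    have hd : ∀ s, HasDerivAt (fun s => (B / A + s ^ 2 / 2) * R s - L s)
        ((B / A + s ^ 2 / 2) * R₁ s) s := fun s => by
      refine HasDerivAt.congr_deriv
        ((((((hasDerivAt_id s).pow 2).div_const 2).const_add (B / A)).mul (dR s)).sub (dL s)) ?_
      simp
    have := nonneg_of_hasDerivAt_nonneg hd
      (fun s hs => mul_nonneg (by positivity) (R₁_nn s hs))
      (by simp only [R0, L0]; apply le_of_eq; field_simp; ring) ht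
    linarith
  refine ⟨R_ge, fun t ht => ?_, fun k => ?_⟩
  · have hd : ∀ s, HasDerivAt (fun s => 2 * (B / A + s ^ 2 / 2) ^ 2 * R s - R₂ s)
        (4 * s * ((B / A + s ^ 2 / 2) * R s - L s) + 2 * (B / A + s ^ 2 / 2) ^ 2 * R₁ s) s :=
      fun s => by
        refine HasDerivAt.congr_deriv
          (((((((hasDerivAt_id s).pow 2).div_const 2).const_add (B / A)).pow 2).const_mul
          2 |>.mul (dR s)).sub (dR₂ s)) ?_
        simp
        ring
    have := nonneg_of_hasDerivAt_nonneg hd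
      (fun s hs => add_nonneg
        (mul_nonneg (by positivity) (sub_nonneg.2 (L_le s hs)))
        (mul_nonneg (by positivity) (R₁_nn s hs)))
      (by simp only [R0, R₂0]; apply le_of_eq; field_simp; ring) ht
    simp only [hR₂] at this
    change _ ≤ _ * R t
    linarith
  · induction k with
    | zero => exact ⟨A ^ 2, by positivity, fun t ht => by simpa using R_ge t ht⟩
    | succ k ih =>
      obtain ⟨c, hc, h⟩ := ih
      have L_ge := fun (t : ℝ) (ht : 0 ≤ t) => mul_pow_succ_le_of_hasDerivAt (c := c)
        (m := 6 * k + 1) dL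
        (fun s hs => by
          have := mul_le_mul_of_nonneg_left (h s hs) hs
          rw [pow_succ]; linarith) (by rw [L0]; positivity) ht
      have R₂_ge := fun (t : ℝ) (ht : 0 ≤ t) => mul_pow_succ_le_of_hasDerivAt
        (c := 4 * (c / (↑(6 * k + 1) + 1))) (m := 6 * k + 1 + 1 + 1) dR₂
        (fun s hs => by
          have := mul_le_mul_of_nonneg_left (L_ge s hs) (by positivity : 0 ≤ 4 * s)
          refine le_trans (le_of_eq ?_) this
          rw [pow_succ _ (6 * k + 1 + 1)]; ring) (R₂_nn 0) ht
      have R₁_ge := fun (t : ℝ) (ht : 0 ≤ t) => mul_pow_succ_le_of_hasDerivAt dR₁ R₂_ge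
        R₁0.ge ht
      have R_ge' := fun (t : ℝ) (ht : 0 ≤ t) => mul_pow_succ_le_of_hasDerivAt dR R₁_ge
        (R_nn 0) ht
      exact ⟨_, by positivity, R_ge'⟩

theorem airy_ray {w w₁ : ℝ → ℂ} (hw : ∀ t, HasDerivAt w (w₁ t) t)
    (hw₁ : ∀ t : ℝ, HasDerivAt w₁ (-(Complex.I * t * w t)) t) {A B : ℝ} (hA : 0 < A) (hB : 0 ≤ B)
    (hw0 : w 0 = A) (hw₁0 : w₁ 0 = -(Complex.I * B)) :
    (∀ t, 0 ≤ t → w t ≠ 0) ∧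
    (∀ t, 0 ≤ t → ‖w₁ t‖ ≤ (B / A + t ^ 2) * ‖w t‖) ∧
    ∀ N : ℕ, ∃ C : ℝ, ∀ t, 0 ≤ t → t ^ N * ‖(w t)⁻¹‖ ≤ C := by
  have re {v v' : ℝ → ℂ} (h : ∀ t, HasDerivAt v (v' t) t) (t : ℝ) :
      HasDerivAt (fun t => (v t).re) (v' t).re t :=
    Complex.reCLM.hasFDerivAt.comp_hasDerivAt t (h t)
  have im {v v' : ℝ → ℂ} (h : ∀ t, HasDerivAt v (v' t) t) (t : ℝ) :
      HasDerivAt (fun t => (v t).im) (v' t).im t :=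
    Complex.imCLM.hasFDerivAt.comp_hasDerivAt t (h t)
  have hn : ∀ z : ℂ, ‖z‖ ^ 2 = z.re ^ 2 + z.im ^ 2 := fun z => by
    rw [Complex.sq_norm, Complex.normSq_apply]; ring
  obtain ⟨h1, h2, h3⟩ := airy_ray_real (re hw) (im hw)
    (fun t => by simpa using re hw₁ t) (fun t => by simpa using im hw₁ t)
    hA hB (by simp [hw0]) (by simp [hw0]) (by simp [hw₁0]) (by simp [hw₁0])
  simp only [← hn] at h1 h2 h3
  have hne : ∀ t, 0 ≤ t → 0 < ‖w t‖ := fun t ht => by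
    have : 0 < ‖w t‖ ^ 2 := (pow_pos hA 2).trans_le (h1 t ht)
    exact lt_of_le_of_ne (norm_nonneg _) fun h0 => by simp [← h0] at this
  refine ⟨fun t ht => norm_pos_iff.1 (hne t ht), fun t ht => ?_, fun N => ?_⟩
  · have := h2 t ht
    rw [← mul_pow] at this
    refine (pow_le_pow_iff_left₀ (norm_nonneg _) (by positivity) two_ne_zero).1 this |>.trans ?_
    gcongr
    nlinarith [sq_nonneg t]
  · obtain ⟨c, hc, h⟩ := h3 N
    refine ⟨1 / A + 1 / Real.sqrt c, fun t ht => ?_⟩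
    rw [norm_inv, ← div_eq_mul_inv]
    have hsc := Real.sqrt_pos.2 hc
    rcases le_total t 1 with h' | h'
    · have : A ≤ ‖w t‖ := (pow_le_pow_iff_left₀ hA.le (norm_nonneg _) two_ne_zero).1 (h1 t ht)
      calc t ^ N / ‖w t‖ ≤ 1 / A := by gcongr; exact pow_le_one₀ ht h'
        _ ≤ _ := by simp
    · have h4 : Real.sqrt c * t ^ N ≤ ‖w t‖ := by
        refine (pow_le_pow_iff_left₀ (by positivity) (norm_nonneg _) two_ne_zero).1
          (le_trans ?_ (h t ht))
        rw [mul_pow, Real.sq_sqrt hc.le, ← pow_mul]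
        exact mul_le_mul_of_nonneg_left (pow_le_pow_right₀ h' (by omega)) hc.le
      calc t ^ N / ‖w t‖ ≤ 1 / Real.sqrt c := by
            rw [div_le_div_iff₀ (hne t ht) hsc]; linarith
        _ ≤ _ := by simp [hA.le]

/-- Rapid decay of an entire solution of the Airy equation along the imaginary axis, for initial
data with the signs of those of the Airy function. -/
theorem airy_imaginary_axis {Ai : ℂ → ℂ} (hAi_d1 : Differentiable ℂ Ai)
    (hAi_d2 : Differentiable ℂ (deriv Ai)) (hAi_ode : ∀ z : ℂ, deriv (deriv Ai) z = z * Ai z)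
    {A B : ℝ} (hA : 0 < A) (hB : 0 ≤ B) (h0 : Ai 0 = A) (h0' : deriv Ai 0 = -(B : ℂ)) :
    (∀ t : ℝ, Ai (Complex.I * t) ≠ 0) ∧
    (∀ t : ℝ, ‖deriv Ai (Complex.I * t)‖ ≤ (B / A + t ^ 2) * ‖Ai (Complex.I * t)‖) ∧
    ∀ N : ℕ, ∃ C : ℝ, ∀ t : ℝ, |t| ^ N * ‖(Ai (Complex.I * t))⁻¹‖ ≤ C := by
  have line (a : ℂ) (t : ℝ) : HasDerivAt (fun t : ℝ => a * (t : ℂ)) a t := by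
    simpa using (Complex.ofRealCLM.hasDerivAt (x := t)).const_mul a
  have d1 (a : ℂ) (t : ℝ) : HasDerivAt (fun t : ℝ => Ai (a * t)) (a * deriv Ai (a * t)) t := by
    have := (hAi_d1 (a * t)).hasDerivAt.comp t (line a t)
    rwa [mul_comm] at this
  have d2 (a : ℂ) (t : ℝ) :
      HasDerivAt (fun t : ℝ => a * deriv Ai (a * t)) (a * (a * (a * t * Ai (a * t)))) t := by
    have := ((hAi_d2 (a * t)).hasDerivAt.comp t (line a t)).const_mul a
    rw [hAi_ode] at this
    exact this.congr_deriv (by ring)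
  have I2 : Complex.I * Complex.I = -1 := Complex.I_mul_I
  obtain ⟨p1, p2, p3⟩ := airy_ray (d1 Complex.I)
    (fun t => (d2 Complex.I t).congr_deriv (by
      linear_combination (Complex.I * t * Ai (Complex.I * t)) * I2))
    hA hB (by simp [h0]) (by simp [h0'])
  obtain ⟨m1, m2, m3⟩ := airy_ray (fun t => (d1 (-Complex.I) t).star)
    (fun t => (d2 (-Complex.I) t).star.congr_deriv (by
      simp
      linear_combination (Complex.I * t * (starRingEnd ℂ) (Ai (-(Complex.I * t)))) * I2))
    hA hB (by simp [h0]) (by simp [h0'])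
  have key {P : ℝ → Prop} (hp : ∀ t, 0 ≤ t → P t) (hm : ∀ t, 0 ≤ t → P (-t)) (t : ℝ) : P t := by
    rcases le_total 0 t with ht | ht
    · exact hp t ht
    · simpa using hm (-t) (by linarith)
  refine ⟨key p1 fun t ht => ?_, key (fun t ht => ?_) fun t ht => ?_, fun N => ?_⟩
  · simpa using m1 t ht
  · simpa using p2 t ht
  · simpa using m2 t ht
  · obtain ⟨C, hC⟩ := p3 N
    obtain ⟨D, hD⟩ := m3 N
    refine ⟨max C D, key (fun t ht => ?_) fun t ht => ?_⟩
    · rw [abs_of_nonneg ht]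
      exact (hC t ht).trans (le_max_left _ _)
    · rw [abs_neg, abs_of_nonneg ht]
      refine le_trans ?_ ((hD t ht).trans (le_max_right _ _))
      simp

/-- A function on the real line decaying faster than any power. -/
def RapidlyDecaying (f : ℝ → ℂ) : Prop :=
  ∀ N : ℕ, ∃ C : ℝ, ∀ t : ℝ, |t| ^ N * ‖f t‖ ≤ C

namespace RapidlyDecaying

variable {f g : ℝ → ℂ}

theorem zero : RapidlyDecaying 0 := fun _ => ⟨0, by simp⟩

theorem add (hf : RapidlyDecaying f) (hg : RapidlyDecaying g) : RapidlyDecaying (f + g) := by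
  intro N
  obtain ⟨C, hC⟩ := hf N
  obtain ⟨D, hD⟩ := hg N
  refine ⟨C + D, fun t => ?_⟩
  calc |t| ^ N * ‖f t + g t‖ ≤ |t| ^ N * (‖f t‖ + ‖g t‖) := by gcongr; exact norm_add_le _ _
    _ ≤ C + D := by rw [mul_add]; exact add_le_add (hC t) (hD t)

theorem mul_of_norm_le (hf : RapidlyDecaying f) {a : ℝ} (m : ℕ)
    (hg : ∀ t, ‖g t‖ ≤ a + |t| ^ m) : RapidlyDecaying (fun t => f t * g t) := by
  intro N
  obtain ⟨C, hC⟩ := hf N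
  obtain ⟨D, hD⟩ := hf (N + m)
  refine ⟨|a| * C + D, fun t => ?_⟩
  have h : ‖g t‖ ≤ |a| + |t| ^ m := (hg t).trans (by gcongr; exact le_abs_self a)
  calc |t| ^ N * ‖f t * g t‖ = |t| ^ N * ‖f t‖ * ‖g t‖ := by rw [norm_mul, mul_assoc]
    _ ≤ |t| ^ N * ‖f t‖ * (|a| + |t| ^ m) := by gcongr
    _ = |a| * (|t| ^ N * ‖f t‖) + |t| ^ (N + m) * ‖f t‖ := by rw [pow_add]; ring
    _ ≤ |a| * C + D := by gcongr; exacts [hC t, hD t]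

theorem const_mul (hf : RapidlyDecaying f) (c : ℂ) : RapidlyDecaying (fun t => c * f t) := by
  simpa only [mul_comm c] using hf.mul_of_norm_le (g := fun _ => c) (a := ‖c‖) 0
    (fun t => by simp)

theorem mul (hf : RapidlyDecaying f) (hg : RapidlyDecaying g) :
    RapidlyDecaying (fun t => f t * g t) := by
  obtain ⟨C, hC⟩ := hg 0
  exact hf.mul_of_norm_le (a := C) 0 fun t => by
    have := hC t
    simp at this ⊢
    linarith

theorem integrable (hf : RapidlyDecaying f) (hc : Continuous f) : MeasureTheory.Integrable f := by
  obtain ⟨C, hC⟩ := hf 0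
  obtain ⟨D, hD⟩ := hf 2
  refine (integrable_inv_one_add_sq.const_mul (C + D)).mono' hc.aestronglyMeasurable
    (Filter.Eventually.of_forall fun t => ?_)
  have h1 := hC t
  have h2 := hD t
  rw [sq_abs] at h2
  rw [← div_eq_mul_inv, le_div_iff₀ (by positivity)]
  simp at h1
  linarith

end RapidlyDecaying

theorem Complex.hasDerivAt_I_mul_ofReal (t : ℝ) :
    HasDerivAt (fun t : ℝ => Complex.I * (t : ℂ)) Complex.I t := by
  simpa using (Complex.ofRealCLM.hasDerivAt (x := t)).const_mul Complex.I

/-- The monomial `u φ^k z^j` at `z = i t`. -/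
noncomputable def airyMonomial (u φ : ℝ → ℂ) (k j : ℕ) (t : ℝ) : ℂ :=
  u t * φ t ^ k * (Complex.I * t) ^ j

/-- Rational combinations of the monomials `u φ^k z^j` of weight `k + 2 j` at most `m`. -/
noncomputable def airySpan (u φ : ℝ → ℂ) (m : ℕ) : Submodule ℚ (ℝ → ℂ) :=
  Submodule.span ℚ {f | ∃ k j : ℕ, k + 2 * j ≤ m ∧ f = airyMonomial u φ k j}

section

variable {u φ : ℝ → ℂ}

theorem airyMonomial_mem_airySpan {k j m : ℕ} (h : k + 2 * j ≤ m) :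
    airyMonomial u φ k j ∈ airySpan u φ m :=
  Submodule.subset_span ⟨k, j, h, rfl⟩

theorem natCast_smul_airyMonomial_mem_airySpan {a k j m : ℕ} (h : a ≠ 0 → k + 2 * j ≤ m) :
    (a : ℚ) • airyMonomial u φ k j ∈ airySpan u φ m := by
  by_cases ha : a = 0
  · simp [ha]
  · exact Submodule.smul_mem _ _ (airyMonomial_mem_airySpan (h ha))

theorem rapidlyDecaying_airyMonomial (hu : RapidlyDecaying u) {K : ℝ}
    (hφ : ∀ t, ‖φ t‖ ≤ K + t ^ 2) (k j : ℕ) : RapidlyDecaying (airyMonomial u φ k j) := by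
  have h1 : RapidlyDecaying (fun t => u t * φ t ^ k) := by
    induction k with
    | zero => simpa using hu
    | succ k ih =>
      simpa only [pow_succ, mul_assoc] using ih.mul_of_norm_le (g := φ) (a := K) 2
        (fun t => by simpa using hφ t)
  exact h1.mul_of_norm_le (a := 0) j (fun t => by simp)

theorem rapidlyDecaying_of_mem_airySpan (hu : RapidlyDecaying u) {K : ℝ}
    (hφ : ∀ t, ‖φ t‖ ≤ K + t ^ 2) {m : ℕ} {f : ℝ → ℂ} (hf : f ∈ airySpan u φ m) :
    RapidlyDecaying f := by
  induction hf using Submodule.span_induction with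
  | mem f hf =>
    obtain ⟨k, j, -, rfl⟩ := hf
    exact rapidlyDecaying_airyMonomial hu hφ k j
  | zero => exact .zero
  | add f g _ _ hf hg => exact hf.add hg
  | smul a f _ hf =>
    convert hf.const_mul a using 2 with t
    simp [Rat.smul_def]

theorem hasDerivAt_airyMonomial (hu : ∀ t, HasDerivAt u (Complex.I * (u t * φ t)) t)
    (hφ : ∀ t : ℝ, HasDerivAt φ (Complex.I * (φ t ^ 2 - Complex.I * t)) t) (k j : ℕ) (t : ℝ) :
    HasDerivAt (airyMonomial u φ k j) (Complex.I *
      ((k + 1) * airyMonomial u φ (k + 1) j t - k * airyMonomial u φ (k - 1) (j + 1) t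
        + j * airyMonomial u φ k (j - 1) t)) t := by
  refine (((hu t).mul ((hφ t).pow k)).mul
    ((Complex.hasDerivAt_I_mul_ofReal t).pow j)).congr_deriv ?_
  simp only [airyMonomial, Pi.mul_apply, Pi.pow_apply]
  rcases k with _ | k
  · simp only [pow_zero, Nat.cast_zero]; ring
  · simp only [Nat.add_sub_cancel, Nat.cast_add, Nat.cast_one]; ring

theorem exists_hasDerivAt_of_mem_airySpan
    (hu : ∀ t, HasDerivAt u (Complex.I * (u t * φ t)) t)
    (hφ : ∀ t : ℝ, HasDerivAt φ (Complex.I * (φ t ^ 2 - Complex.I * t)) t)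
    {m : ℕ} {f : ℝ → ℂ} (hf : f ∈ airySpan u φ m) :
    ∃ f' ∈ airySpan u φ (m + 1), ∀ t, HasDerivAt f (Complex.I * f' t) t := by
  induction hf using Submodule.span_induction with
  | mem f hf =>
    obtain ⟨k, j, h, rfl⟩ := hf
    refine ⟨((k + 1 : ℕ) : ℚ) • airyMonomial u φ (k + 1) j
      - (k : ℚ) • airyMonomial u φ (k - 1) (j + 1) + (j : ℚ) • airyMonomial u φ k (j - 1),
      Submodule.add_mem _ (Submodule.sub_mem _ ?_ ?_) ?_, fun t =>
        (hasDerivAt_airyMonomial hu hφ k j t).congr_deriv (by simp [Rat.smul_def])⟩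
    all_goals exact natCast_smul_airyMonomial_mem_airySpan (by omega)
  | zero => exact ⟨0, Submodule.zero_mem _, fun t => by simp⟩
  | add f g _ _ hf hg =>
    obtain ⟨f', hf', df⟩ := hf
    obtain ⟨g', hg', dg⟩ := hg
    exact ⟨f' + g', Submodule.add_mem _ hf' hg', fun t =>
      ((df t).add (dg t)).congr_deriv (by simp [mul_add])⟩
  | smul a f _ hf =>
    obtain ⟨f', hf', df⟩ := hf
    exact ⟨a • f', Submodule.smul_mem _ _ hf', fun t =>
      ((df t).const_smul a).congr_deriv (by simp [Rat.smul_def]; ring)⟩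

theorem exists_iteratedDeriv_eq_of_airy
    (hu : ∀ t, HasDerivAt u (Complex.I * (u t * φ t)) t)
    (hφ : ∀ t : ℝ, HasDerivAt φ (Complex.I * (φ t ^ 2 - Complex.I * t)) t) (n : ℕ) :
    ∃ q ∈ airySpan u φ n, iteratedDeriv n u = fun t => Complex.I ^ n * q t := by
  induction n with
  | zero =>
    refine ⟨airyMonomial u φ 0 0, airyMonomial_mem_airySpan le_rfl, ?_⟩
    ext t
    simp [airyMonomial]
  | succ n ih =>
    obtain ⟨q, hq, h⟩ := ih
    obtain ⟨q', hq', dq⟩ := exists_hasDerivAt_of_mem_airySpan hu hφ hq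
    refine ⟨q', hq', ?_⟩
    ext t
    rw [iteratedDeriv_succ, h, ((dq t).const_mul _).deriv, pow_succ, mul_assoc]

theorem continuous_of_mem_airySpan
    (hu : ∀ t, HasDerivAt u (Complex.I * (u t * φ t)) t)
    (hφ : ∀ t : ℝ, HasDerivAt φ (Complex.I * (φ t ^ 2 - Complex.I * t)) t)
    {m : ℕ} {f : ℝ → ℂ} (hf : f ∈ airySpan u φ m) : Continuous f := by
  obtain ⟨f', -, df⟩ := exists_hasDerivAt_of_mem_airySpan hu hφ hf
  exact continuous_iff_continuousAt.2 fun t => (df t).continuousAt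

theorem integrable_mul_of_mem_airySpan
    (hu : ∀ t, HasDerivAt u (Complex.I * (u t * φ t)) t)
    (hφ : ∀ t : ℝ, HasDerivAt φ (Complex.I * (φ t ^ 2 - Complex.I * t)) t)
    (hud : RapidlyDecaying u) {K : ℝ} (hφK : ∀ t, ‖φ t‖ ≤ K + t ^ 2)
    {m : ℕ} {f : ℝ → ℂ} (hf : f ∈ airySpan u φ m) :
    MeasureTheory.Integrable fun t => u t * f t :=
  (hud.mul (rapidlyDecaying_of_mem_airySpan hud hφK hf)).integrable
    ((continuous_iff_continuousAt.2 fun t => (hu t).continuousAt).mul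
      (continuous_of_mem_airySpan hu hφ hf))

theorem integral_mul_airyMonomial_succ
    (hu : ∀ t, HasDerivAt u (Complex.I * (u t * φ t)) t)
    (hφ : ∀ t : ℝ, HasDerivAt φ (Complex.I * (φ t ^ 2 - Complex.I * t)) t)
    (hud : RapidlyDecaying u) {K : ℝ} (hφK : ∀ t, ‖φ t‖ ≤ K + t ^ 2) (k j : ℕ) :
    ∫ t, u t * airyMonomial u φ (k + 1) j t =
      k / (k + 2) * (∫ t, u t * airyMonomial u φ (k - 1) (j + 1) t)
        - j / (k + 2) * ∫ t, u t * airyMonomial u φ k (j - 1) t := by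
  have h_int (k j : ℕ) : MeasureTheory.Integrable fun t => u t * airyMonomial u φ k j t :=
    integrable_mul_of_mem_airySpan hu hφ hud hφK (airyMonomial_mem_airySpan le_rfl)
  have i1 := (h_int (k + 1) j).const_mul (k + 2 : ℂ)
  have i2 := (h_int (k - 1) (j + 1)).const_mul (k : ℂ)
  have i3 := (h_int k (j - 1)).const_mul (j : ℂ)
  have hd (t : ℝ) : HasDerivAt (fun t => u t * airyMonomial u φ k j t)
      (Complex.I * ((k + 2) * (u t * airyMonomial u φ (k + 1) j t)
        - k * (u t * airyMonomial u φ (k - 1) (j + 1) t)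
        + j * (u t * airyMonomial u φ k (j - 1) t))) t := by
    refine ((hu t).mul (hasDerivAt_airyMonomial hu hφ k j t)).congr_deriv ?_
    simp only [airyMonomial]
    ring
  have h0 := MeasureTheory.integral_eq_zero_of_hasDerivAt_of_integrable hd
    (((i1.sub i2).add i3).const_mul _) (h_int k j)
  have h12 := i1.sub i2
  simp only [Pi.sub_def] at h12
  rw [MeasureTheory.integral_const_mul, mul_eq_zero, or_iff_right Complex.I_ne_zero,
    MeasureTheory.integral_add h12 i3, MeasureTheory.integral_sub i1 i2,
    MeasureTheory.integral_const_mul, MeasureTheory.integral_const_mul,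
    MeasureTheory.integral_const_mul] at h0
  have hk : (k : ℂ) + 2 ≠ 0 := by exact_mod_cast (by omega : k + 2 ≠ 0)
  field_simp
  linear_combination h0

theorem integrable_mul_aeval
    (hu : ∀ t, HasDerivAt u (Complex.I * (u t * φ t)) t) (hud : RapidlyDecaying u)
    (p : Polynomial ℚ) :
    MeasureTheory.Integrable fun t : ℝ => u t ^ 2 * Polynomial.aeval (Complex.I * (t : ℂ)) p := by
  have hc : Continuous u := continuous_iff_continuousAt.2 fun t => (hu t).continuousAt
  induction p using Polynomial.induction_on' with
  | add p q hp hq => simpa only [map_add, mul_add, Pi.add_def] using hp.add hq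
  | monomial n a =>
    have h := (((hud.mul hud).mul_of_norm_le (g := fun t => (Complex.I * (t : ℂ)) ^ n) (a := 0) n
      (fun t => by simp)).integrable (by fun_prop)).const_mul (a : ℂ)
    refine h.congr (Filter.Eventually.of_forall fun t => ?_)
    simp [Polynomial.aeval_monomial]
    ring

theorem exists_polynomial_integral_mul_airyMonomial
    (hu : ∀ t, HasDerivAt u (Complex.I * (u t * φ t)) t)
    (hφ : ∀ t : ℝ, HasDerivAt φ (Complex.I * (φ t ^ 2 - Complex.I * t)) t)
    (hud : RapidlyDecaying u) {K : ℝ} (hφK : ∀ t, ‖φ t‖ ≤ K + t ^ 2) {n : ℕ} (k : ℕ) :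
    ∀ j, k + 2 * j ≤ n → ∃ p : Polynomial ℚ, p.natDegree ≤ n / 2 ∧
      ∫ t, u t * airyMonomial u φ k j t =
        ∫ t : ℝ, u t ^ 2 * Polynomial.aeval (Complex.I * (t : ℂ)) p := by
  induction k using Nat.strong_induction_on with
  | h k ih =>
    intro j hj
    rcases k with _ | k
    · refine ⟨Polynomial.X ^ j, by rw [Polynomial.natDegree_X_pow]; omega, ?_⟩
      congr 1 with t
      simp [airyMonomial]
      ring
    · have h1 : ∃ p : Polynomial ℚ, p.natDegree ≤ n / 2 ∧
          (k : ℂ) / (k + 2) * (∫ t, u t * airyMonomial u φ (k - 1) (j + 1) t) =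
            ∫ t : ℝ, u t ^ 2 * Polynomial.aeval (Complex.I * (t : ℂ)) p := by
        rcases k with _ | k
        · exact ⟨0, by simp⟩
        · obtain ⟨p, hp, h⟩ := ih k (by omega) (j + 1) (by omega)
          refine ⟨Polynomial.C (((k + 1 : ℕ) : ℚ) / ((k + 1 : ℕ) + 2)) * p,
            (Polynomial.natDegree_C_mul_le _ _).trans hp, ?_⟩
          rw [Nat.add_sub_cancel, h, ← MeasureTheory.integral_const_mul]
          congr 1 with t
          simp
          ring
      obtain ⟨p₁, hp₁, h₁⟩ := h1
      obtain ⟨p₂, hp₂, h₂⟩ := ih k (by omega) (j - 1) (by omega)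
      refine ⟨p₁ - Polynomial.C ((j : ℚ) / (k + 2)) * p₂,
        (Polynomial.natDegree_sub_le_of_le hp₁
          ((Polynomial.natDegree_C_mul_le _ _).trans hp₂)).trans (max_self _).le, ?_⟩
      rw [integral_mul_airyMonomial_succ hu hφ hud hφK, h₁, h₂,
        ← MeasureTheory.integral_const_mul, ← MeasureTheory.integral_sub
          (integrable_mul_aeval hu hud _) ((integrable_mul_aeval hu hud _).const_mul _)]
      congr 1 with t
      simp
      ring

theorem exists_polynomial_integral_mul_of_mem_airySpan
    (hu : ∀ t, HasDerivAt u (Complex.I * (u t * φ t)) t)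
    (hφ : ∀ t : ℝ, HasDerivAt φ (Complex.I * (φ t ^ 2 - Complex.I * t)) t)
    (hud : RapidlyDecaying u) {K : ℝ} (hφK : ∀ t, ‖φ t‖ ≤ K + t ^ 2) {n : ℕ} {f : ℝ → ℂ}
    (hf : f ∈ airySpan u φ n) : ∃ p : Polynomial ℚ, p.natDegree ≤ n / 2 ∧
      ∫ t, u t * f t = ∫ t : ℝ, u t ^ 2 * Polynomial.aeval (Complex.I * (t : ℂ)) p := by
  induction hf using Submodule.span_induction with
  | mem f hf =>
    obtain ⟨k, j, h, rfl⟩ := hf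
    exact exists_polynomial_integral_mul_airyMonomial hu hφ hud hφK k j h
  | zero => exact ⟨0, by simp⟩
  | add f g hf' hg' hf hg =>
    obtain ⟨p, hp, h⟩ := hf
    obtain ⟨q, hq, h'⟩ := hg
    refine ⟨p + q, Polynomial.natDegree_add_le_of_degree_le hp hq, ?_⟩
    simp only [Pi.add_apply, map_add, mul_add]
    rw [MeasureTheory.integral_add (integrable_mul_of_mem_airySpan hu hφ hud hφK hf')
      (integrable_mul_of_mem_airySpan hu hφ hud hφK hg'), h, h', MeasureTheory.integral_add
      (integrable_mul_aeval hu hud _) (integrable_mul_aeval hu hud _)]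
  | smul a f _ hf =>
    obtain ⟨p, hp, h⟩ := hf
    refine ⟨Polynomial.C a * p, (Polynomial.natDegree_C_mul_le _ _).trans hp, ?_⟩
    have h2 (x y : ℂ) : x * (a * y) = a * (x * y) := by ring
    simp only [Pi.smul_apply, Rat.smul_def, map_mul, Polynomial.aeval_C, eq_ratCast, h2,
      MeasureTheory.integral_const_mul, h]

end

section

open FourierTransform SchwartzMap

theorem SchwartzMap.exists_coe_eq_iteratedDeriv (F : 𝓢(ℝ, ℂ)) (n : ℕ) :
    ∃ G : 𝓢(ℝ, ℂ), ⇑G = iteratedDeriv n F := by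
  induction n with
  | zero => exact ⟨F, by simp⟩
  | succ n ih =>
    obtain ⟨G, hG⟩ := ih
    refine ⟨derivCLM ℂ ℂ G, ?_⟩
    ext t
    rw [derivCLM_apply, hG, iteratedDeriv_succ]

theorem SchwartzMap.integral_pow_mul_fourier_mul_fourier_neg (F : 𝓢(ℝ, ℂ)) (n : ℕ) :
    ∫ ξ : ℝ, (2 * Real.pi * Complex.I * ξ) ^ n * 𝓕 (F : ℝ → ℂ) ξ * 𝓕 (F : ℝ → ℂ) (-ξ) =
      ∫ t, F t * iteratedDeriv n F t := by
  obtain ⟨G, hG⟩ := F.exists_coe_eq_iteratedDeriv n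
  have h1 : 𝓕 (iteratedDeriv n F) =
      fun x : ℝ => (2 * Real.pi * Complex.I * x) ^ n • 𝓕 (F : ℝ → ℂ) x :=
    Real.fourier_iteratedDeriv (N := ⊤) (F.smooth ⊤) (fun m _ => by
      obtain ⟨G, hG⟩ := F.exists_coe_eq_iteratedDeriv m
      exact hG ▸ G.integrable) le_top
  have h2 := integral_fourier_mul_eq G (𝓕⁻ F)
  rw [fourier_fourierInv_eq, fourier_coe, hG, h1] at h2
  simp only [fourierInv_coe, Real.fourierInv_eq_fourier_neg, smul_eq_mul] at h2
  rw [h2]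
  simp only [mul_comm]

theorem SchwartzMap.integral_pow_mul_mul_neg (F : 𝓢(ℝ, ℂ)) {g : ℝ → ℂ}
    (hg : ∀ x : ℝ, g x = (1 / (2 * (Real.pi : ℂ))) *
      ∫ t : ℝ, Complex.exp (-(Complex.I * t * x)) * F t) (n : ℕ) :
    Complex.I ^ n * ∫ x : ℝ, (x : ℂ) ^ n * (g x * g (-x)) =
      (1 / (2 * (Real.pi : ℂ))) * ∫ t, F t * iteratedDeriv n F t := by
  have hpi : (Real.pi : ℂ) ≠ 0 := by exact_mod_cast Real.pi_ne_zero
  have hg' (x : ℝ) : g x = (1 / (2 * (Real.pi : ℂ))) * 𝓕 (F : ℝ → ℂ) ((2 * Real.pi)⁻¹ * x) := by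
    rw [hg, Real.fourier_real_eq_integral_exp_smul]
    congr 2 with t
    rw [smul_eq_mul]
    congr 2
    push_cast
    field_simp
  have key := MeasureTheory.Measure.integral_comp_mul_left
    (fun ξ : ℝ => (2 * Real.pi * Complex.I * ξ) ^ n * 𝓕 (F : ℝ → ℂ) ξ * 𝓕 (F : ℝ → ℂ) (-ξ))
    (2 * Real.pi)⁻¹
  rw [integral_pow_mul_fourier_mul_fourier_neg, inv_inv, abs_of_pos Real.two_pi_pos,
    Complex.real_smul] at key
  have h : ∀ x : ℝ, Complex.I ^ n * ((x : ℂ) ^ n * (g x * g (-x))) = (1 / (2 * (Real.pi : ℂ))) ^ 2 *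
      ((2 * Real.pi * Complex.I * (((2 * Real.pi)⁻¹ * x : ℝ) : ℂ)) ^ n *
        𝓕 (F : ℝ → ℂ) ((2 * Real.pi)⁻¹ * x) * 𝓕 (F : ℝ → ℂ) (-((2 * Real.pi)⁻¹ * x))) := fun x => by
    have : 2 * Real.pi * Complex.I * (((2 * Real.pi)⁻¹ * x : ℝ) : ℂ) = Complex.I * x := by
      push_cast
      field_simp
    rw [this, hg', hg', mul_neg]
    ring
  rw [← MeasureTheory.integral_const_mul]
  simp only [h]
  rw [MeasureTheory.integral_const_mul, key]
  push_cast
  field_simp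

end

theorem rapidlyDecaying_iteratedDeriv_of_airy {u φ : ℝ → ℂ}
    (hu : ∀ t, HasDerivAt u (Complex.I * (u t * φ t)) t)
    (hφ : ∀ t : ℝ, HasDerivAt φ (Complex.I * (φ t ^ 2 - Complex.I * t)) t)
    (hud : RapidlyDecaying u) {K : ℝ} (hφK : ∀ t, ‖φ t‖ ≤ K + t ^ 2) (n : ℕ) :
    RapidlyDecaying (iteratedDeriv n u) := by
  obtain ⟨q, hq, h⟩ := exists_iteratedDeriv_eq_of_airy hu hφ n
  rw [h]
  exact (rapidlyDecaying_of_mem_airySpan hud hφK hq).const_mul _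

theorem contDiff_of_airy {u φ : ℝ → ℂ}
    (hu : ∀ t, HasDerivAt u (Complex.I * (u t * φ t)) t)
    (hφ : ∀ t : ℝ, HasDerivAt φ (Complex.I * (φ t ^ 2 - Complex.I * t)) t) :
    ContDiff ℝ (⊤ : ℕ∞) u := by
  refine contDiff_of_differentiable_iteratedDeriv fun m _ => ?_
  obtain ⟨q, hq, h⟩ := exists_iteratedDeriv_eq_of_airy hu hφ m
  obtain ⟨q', -, dq⟩ := exists_hasDerivAt_of_mem_airySpan hu hφ hq
  rw [h]
  exact fun t => ((dq t).const_mul _).differentiableAt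

/-- The moment identity for the inverse Fourier transform of a solution `u` of the logarithmic
Airy system. -/
theorem exists_polynomial_moment_of_airy {u φ : ℝ → ℂ}
    (hu : ∀ t, HasDerivAt u (Complex.I * (u t * φ t)) t)
    (hφ : ∀ t : ℝ, HasDerivAt φ (Complex.I * (φ t ^ 2 - Complex.I * t)) t)
    (hud : RapidlyDecaying u) {K : ℝ} (hφK : ∀ t, ‖φ t‖ ≤ K + t ^ 2) {g : ℝ → ℂ}
    (hg : ∀ x : ℝ, g x = (1 / (2 * (Real.pi : ℂ))) *
      ∫ t : ℝ, Complex.exp (-(Complex.I * t * x)) * u t) (n : ℕ) :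
    ∃ p : Polynomial ℚ, p.natDegree ≤ n / 2 ∧
      ∫ x : ℝ, (x : ℂ) ^ n * (g x * g (-x)) = (1 / (2 * (Real.pi : ℂ))) *
        ∫ t : ℝ, u t ^ 2 * Polynomial.aeval (Complex.I * (t : ℂ)) p := by
  let F : SchwartzMap ℝ ℂ :=
    { toFun := u
      smooth' := contDiff_of_airy hu hφ
      decay' := fun k m => by
        simpa only [Real.norm_eq_abs, norm_iteratedFDeriv_eq_norm_iteratedDeriv] using
          rapidlyDecaying_iteratedDeriv_of_airy hu hφ hud hφK m k }
  obtain ⟨q, hq, h⟩ := exists_iteratedDeriv_eq_of_airy hu hφ n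
  obtain ⟨p, hp, h'⟩ := exists_polynomial_integral_mul_of_mem_airySpan hu hφ hud hφK hq
  refine ⟨p, hp, ?_⟩
  have key := F.integral_pow_mul_mul_neg hg n
  change _ = _ * ∫ t, u t * iteratedDeriv n u t at key
  simp only [h, mul_left_comm _ (Complex.I ^ n)] at key
  rw [MeasureTheory.integral_const_mul, h', mul_left_comm] at key
  exact mul_left_cancel₀ (pow_ne_zero n Complex.I_ne_zero) key

theorem chernoff_even_moment_polynomial (Ai : ℂ → ℂ)
    (hAi_d1 : Differentiable ℂ Ai)
    (hAi_d2 : Differentiable ℂ (deriv Ai))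
    (hAi_ode : ∀ z : ℂ, deriv (deriv Ai) z = z * Ai z)
    (hAi_0 : Ai 0 = (3 : ℂ) ^ (-(2 : ℂ) / 3) / Complex.Gamma (2 / 3))
    (hAi_0' : deriv Ai 0 = -(3 : ℂ) ^ (-(1 : ℂ) / 3) / Complex.Gamma (1 / 3))
    (hAi_zeros : ∀ z : ℂ, Ai z = 0 → ∃ x : ℝ, x < 0 ∧ z = (x : ℂ))
    (g : ℝ → ℝ)
    (hg : ∀ x : ℝ, (g x : ℂ) =
      (1 / (2 * (Real.pi : ℂ))) *
        ∫ t : ℝ, Complex.exp (-(Complex.I * t * x)) * ((Real.sqrt 2 : ℂ) / Ai (Complex.I * t)))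
    (f : ℝ → ℝ)
    (hf : ∀ x : ℝ, f x = (1 / 2) * g x * g (-x)) :
    ∀ n : ℕ, 0 < n → Even n →
      ∃ p : Polynomial ℚ, p.natDegree ≤ n / 2 ∧
        ((∫ x : ℝ, x ^ n * f x : ℝ) : ℂ) =
          (1 / (2 * (Real.pi : ℂ))) *
            ∫ y : ℝ, Polynomial.aeval (Complex.I * (y : ℂ)) p / (Ai (Complex.I * y)) ^ 2 := by
  have hA : 0 < (3 : ℝ) ^ (-(2 : ℝ) / 3) / Real.Gamma (2 / 3) :=
    div_pos (by positivity) (Real.Gamma_pos_of_pos (by norm_num))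
  have hB : 0 < (3 : ℝ) ^ (-(1 : ℝ) / 3) / Real.Gamma (1 / 3) :=
    div_pos (by positivity) (Real.Gamma_pos_of_pos (by norm_num))
  obtain ⟨hne, hle, hdec⟩ := airy_imaginary_axis hAi_d1 hAi_d2 hAi_ode hA hB.le
    (by
      rw [hAi_0, Complex.ofReal_div, ← Complex.Gamma_ofReal,
        Complex.ofReal_cpow (by norm_num)]
      push_cast
      rfl)
    (by
      rw [hAi_0', Complex.ofReal_div, ← Complex.Gamma_ofReal,
        Complex.ofReal_cpow (by norm_num)]
      push_cast
      rw [neg_div])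
  have dAi (t : ℝ) : HasDerivAt (fun t : ℝ => Ai (Complex.I * t))
      (deriv Ai (Complex.I * t) * Complex.I) t :=
    (hAi_d1 _).hasDerivAt.comp t (Complex.hasDerivAt_I_mul_ofReal t)
  have dAi' (t : ℝ) : HasDerivAt (fun t : ℝ => deriv Ai (Complex.I * t))
      (Complex.I * t * Ai (Complex.I * t) * Complex.I) t := by
    have := (hAi_d2 (Complex.I * t)).hasDerivAt.comp t (Complex.hasDerivAt_I_mul_ofReal t)
    rwa [hAi_ode] at this
  have hu (t : ℝ) : HasDerivAt (fun t : ℝ => (Ai (Complex.I * t))⁻¹) (Complex.I *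
      ((Ai (Complex.I * t))⁻¹ * -(deriv Ai (Complex.I * t) / Ai (Complex.I * t)))) t := by
    refine ((dAi t).inv (hne t)).congr_deriv ?_
    have := hne t
    field_simp
  have hφ (t : ℝ) : HasDerivAt (fun t : ℝ => -(deriv Ai (Complex.I * t) / Ai (Complex.I * t)))
      (Complex.I * ((-(deriv Ai (Complex.I * t) / Ai (Complex.I * t))) ^ 2 - Complex.I * t)) t := by
    refine ((dAi' t).div (dAi t) (hne t)).neg.congr_deriv ?_
    have := hne t
    field_simp
    ring
  intro n _ _
  obtain ⟨p, hp, h⟩ := exists_polynomial_moment_of_airy hu hφ hdec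
    (fun t => by
      rw [norm_neg, norm_div, div_le_iff₀ (norm_pos_iff.2 (hne t))]
      exact hle t)
    (g := fun x => g x / Real.sqrt 2)
    (fun x => by
      have h2 : (Real.sqrt 2 : ℂ) ≠ 0 := by simp
      rw [hg]
      simp only [div_eq_mul_inv, mul_left_comm _ (Real.sqrt 2 : ℂ)]
      rw [MeasureTheory.integral_const_mul, mul_left_comm, mul_right_comm, mul_inv_cancel₀ h2,
        one_mul]) n
  refine ⟨p, hp, ?_⟩
  have h2 : (Real.sqrt 2 : ℂ) ^ 2 = 2 := by
    rw [← Complex.ofReal_pow, Real.sq_sqrt (by norm_num)]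
    norm_num
  calc ((∫ x : ℝ, x ^ n * f x : ℝ) : ℂ)
      = ∫ x : ℝ, (x : ℂ) ^ n * (g x / Real.sqrt 2 * (g (-x) / Real.sqrt 2)) := by
        rw [← integral_complex_ofReal]
        congr 1 with x
        rw [hf, div_mul_div_comm, ← sq, h2]
        push_cast
        ring
    _ = _ := by
        rw [h]
        congr 2 with t
        rw [inv_pow, div_eq_inv_mul]
end

section
/- For every even positive integer n there exists a polynomial p_n with rational coefficients and degree at most n/2, all of whose nonzero monomials z^j satisfy j ≡ n/2 (mod 3), such that the n-th moment of the Chernoff density satisfies ∫_ℝ x^n f(x) dx = (1/(2πi)) ∫_{−i∞}^{i∞} p_n(z)/Ai(z)² dz = (1/(2π)) ∫_ℝ p_n(iy)/Ai(iy)² dy. -/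
open scoped Real FourierTransform SchwartzMap

namespace ChernoffMoment

theorem le_of_hasDerivAt_nonneg {f f' : ℝ → ℝ} {a t : ℝ} (hf : ∀ s, HasDerivAt f (f' s) s)
    (hf' : ∀ s, a ≤ s → 0 ≤ f' s) (hat : a ≤ t) : f a ≤ f t := by
  refine monotoneOn_of_deriv_nonneg (convex_Ici a)
    (fun s _ => (hf s).continuousAt.continuousWithinAt)
    (fun s _ => (hf s).differentiableAt.differentiableWithinAt) ?_
    Set.self_mem_Ici hat hat
  intro s hs
  rw [interior_Ici] at hs
  rw [(hf s).deriv]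
  exact hf' s (le_of_lt hs)

/-- Growth of a cooperative linear system: `P` and `Q` play the role of `‖w‖²` and `‖w'‖²`, and
`A`, `B` those of the real and imaginary parts of `w' * conj w`, for `w'' = -i t w`. -/
theorem exists_growth_bound {P A B Q : ℝ → ℝ}
    (hP : ∀ t, HasDerivAt P (2 * A t) t) (hA : ∀ t, HasDerivAt A (Q t) t)
    (hB : ∀ t, HasDerivAt B (t * P t) t) (hQ : ∀ t, HasDerivAt Q (2 * t * B t) t)
    (hAPQ : ∀ t, 2 * A t ≤ P t + Q t) (hQ_nonneg : ∀ t, 0 ≤ Q t)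
    (hP0 : 0 < P 0) (hA0 : 0 ≤ A 0) (hB0 : 0 ≤ B 0) :
    ∃ C, ∀ t, 0 ≤ t →
      0 < P t ∧ Q t ≤ C * (1 + t) ^ 4 * P t ∧ Real.exp t ≤ C * (1 + t) ^ 4 * P t := by
  have hA_nonneg : ∀ t, 0 ≤ t → 0 ≤ A t := fun t ht =>
    hA0.trans (le_of_hasDerivAt_nonneg hA (fun s _ => hQ_nonneg s) ht)
  have hP_ge : ∀ t, 0 ≤ t → P 0 ≤ P t := fun t ht =>
    le_of_hasDerivAt_nonneg hP (fun s hs => by linarith [hA_nonneg s hs]) ht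
  have hB_nonneg : ∀ t, 0 ≤ t → 0 ≤ B t := fun t ht =>
    hB0.trans (le_of_hasDerivAt_nonneg hB
      (fun s hs => mul_nonneg hs (hP0.le.trans (hP_ge s hs))) ht)
  obtain ⟨b, hb, hbB⟩ : ∃ b, 0 ≤ b ∧ b * P 0 = B 0 :=
    ⟨B 0 / P 0, by positivity, by field_simp⟩
  obtain ⟨q, hq, hqQ⟩ : ∃ q, 0 ≤ q ∧ q * P 0 = Q 0 :=
    ⟨Q 0 / P 0, div_nonneg (hQ_nonneg 0) hP0.le, by field_simp⟩
  have hB_le : ∀ t, 0 ≤ t → B t ≤ (b + t ^ 2 / 2) * P t := by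
    intro t ht
    have key := le_of_hasDerivAt_nonneg (a := 0) (t := t)
      (f := fun s => (b + s ^ 2 / 2) * P s - B s)
      (f' := fun s => (b + s ^ 2 / 2) * (2 * A s))
      (fun s => by
        have h := ((((hasDerivAt_pow 2 s).div_const 2).const_add b).mul (hP s)).sub (hB s)
        convert! h using 1
        push_cast; ring)
      (fun s hs => by have := hA_nonneg s hs; positivity) ht
    nlinarith
  have hQ_le : ∀ t, 0 ≤ t → Q t ≤ (q + b * t ^ 2 + t ^ 4 / 4) * P t := by
    intro t ht
    have key := le_of_hasDerivAt_nonneg (a := 0) (t := t)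
      (f := fun s => (q + b * s ^ 2 + s ^ 4 / 4) * P s - Q s)
      (f' := fun s => (2 * b * s + s ^ 3) * P s + (q + b * s ^ 2 + s ^ 4 / 4) * (2 * A s)
        - 2 * s * B s)
      (fun s => by
        have h := (((((hasDerivAt_pow 2 s).const_mul b).const_add q).add
          ((hasDerivAt_pow 4 s).div_const 4)).mul (hP s)).sub (hQ s)
        convert! h using 1
        simp only [Pi.add_apply]
        push_cast; ring)
      (fun s hs => by
        have h1 := hA_nonneg s hs
        have h2 := mul_le_mul_of_nonneg_left (hB_le s hs) (by positivity : 0 ≤ 2 * s)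
        have h3 : 0 ≤ (q + b * s ^ 2 + s ^ 4 / 4) * (2 * A s) := by positivity
        nlinarith) ht
    nlinarith
  have hS : ∀ t, 0 ≤ t → P 0 * Real.exp (t - 1) ≤ P t + A t + Q t + B t := by
    intro t ht
    rcases le_total t 1 with h1 | h1
    · have h2 : Real.exp (t - 1) ≤ 1 := Real.exp_le_one_iff.2 (by linarith)
      nlinarith [hA_nonneg t ht, hB_nonneg t ht, hQ_nonneg t, hP_ge t ht]
    · have key := le_of_hasDerivAt_nonneg (a := 1) (t := t)
        (f := fun s => (P s + A s + Q s + B s) * Real.exp (-(s - 1)))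
        (f' := fun s => (A s + (s - 1) * P s + (2 * s - 1) * B s) * Real.exp (-(s - 1)))
        (fun s => by
          have h := ((((hP s).add (hA s)).add (hQ s)).add (hB s)).mul
            (((hasDerivAt_id s).sub_const 1).neg.exp)
          convert! h using 1
          simp only [Pi.add_apply, Pi.neg_apply, id]
          ring)
        (fun s hs => by
          have h0 : 0 ≤ s := by linarith
          have h2 := hA_nonneg s h0
          have h3 := hB_nonneg s h0
          have h4 := hP0.le.trans (hP_ge s h0)
          have h5 : 0 ≤ s - 1 := by linarith
          have h6 : 0 ≤ 2 * s - 1 := by linarith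
          positivity) h1
      simp only [sub_self, neg_zero, Real.exp_zero, mul_one, Real.exp_neg] at key
      rw [← div_eq_mul_inv, le_div_iff₀ (Real.exp_pos _)] at key
      refine le_trans (mul_le_mul_of_nonneg_right ?_ (Real.exp_pos _).le) key
      linarith [hA_nonneg 1 zero_le_one, hB_nonneg 1 zero_le_one, hQ_nonneg 1,
        hP_ge 1 zero_le_one]
  have hpoly : ∀ t : ℝ, 0 ≤ t → q + b * t ^ 2 + t ^ 4 / 4 ≤ (q + b + 1) * (1 + t) ^ 4 ∧
      b + t ^ 2 / 2 ≤ (q + b + 1) * (1 + t) ^ 4 ∧ 1 ≤ (q + b + 1) * (1 + t) ^ 4 := by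
    intro t ht
    have e : (1 + t) ^ 4 = 1 + 4 * t + 6 * t ^ 2 + 4 * t ^ 3 + t ^ 4 := by ring
    have ht2 := pow_nonneg ht 2
    have ht3 := pow_nonneg ht 3
    have ht4 := pow_nonneg ht 4
    have h1 : 1 ≤ (1 + t) ^ 4 := by linarith
    have h2 : t ^ 2 ≤ (1 + t) ^ 4 := by linarith
    have h4 : t ^ 4 ≤ (1 + t) ^ 4 := by linarith
    have hq1 := mul_le_mul_of_nonneg_left h1 hq
    have hb1 := mul_le_mul_of_nonneg_left h1 hb
    have hb2 := mul_le_mul_of_nonneg_left h2 hb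
    refine ⟨?_, ?_, ?_⟩ <;> nlinarith
  set M := q + b + 1 with hM
  have hM1 : 1 ≤ M := by linarith
  have hPe : 0 ≤ Real.exp 1 / P 0 := by positivity
  refine ⟨M + Real.exp 1 / P 0 * (5 * M), fun t ht => ?_⟩
  obtain ⟨h1, h2, h3⟩ := hpoly t ht
  have hPt : 0 < P t := hP0.trans_le (hP_ge t ht)
  have hQM : Q t ≤ M * (1 + t) ^ 4 * P t :=
    (hQ_le t ht).trans (mul_le_mul_of_nonneg_right h1 hPt.le)
  have hBM : B t ≤ M * (1 + t) ^ 4 * P t :=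
    (hB_le t ht).trans (mul_le_mul_of_nonneg_right h2 hPt.le)
  have hPM : P t ≤ M * (1 + t) ^ 4 * P t := by
    simpa using mul_le_mul_of_nonneg_right h3 hPt.le
  have hX : 0 ≤ M * (1 + t) ^ 4 * P t := by positivity
  refine ⟨hPt, ?_, ?_⟩
  · refine hQM.trans ?_
    have : 0 ≤ Real.exp 1 / P 0 * (5 * M) * (1 + t) ^ 4 * P t := by positivity
    nlinarith
  · have h5 : P 0 * Real.exp (t - 1) ≤ 5 * (M * (1 + t) ^ 4 * P t) := by
      linarith [hS t ht, hAPQ t]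
    have h6 : Real.exp t = Real.exp 1 / P 0 * (P 0 * Real.exp (t - 1)) := by
      rw [Real.exp_sub]
      field_simp
    rw [h6]
    refine (mul_le_mul_of_nonneg_left h5 hPe).trans ?_
    nlinarith

/-- Solutions of the Airy equation restricted to a half of the imaginary axis grow exponentially,
with a polynomially bounded logarithmic derivative. -/
theorem exists_bound_of_airy_ode {w w₁ : ℝ → ℂ} {a b : ℝ}
    (hw : ∀ t, HasDerivAt w (w₁ t) t)
    (hw₁ : ∀ t : ℝ, HasDerivAt w₁ (-(Complex.I * t * w t)) t)
    (hw0 : w 0 = a) (hw₁0 : w₁ 0 = Complex.I * b) (ha : a ≠ 0) (hab : a * b ≤ 0) :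
    ∃ C, ∀ t, 0 ≤ t → 0 < ‖w t‖ ^ 2 ∧ ‖w₁ t‖ ^ 2 ≤ C * (1 + t) ^ 4 * ‖w t‖ ^ 2 ∧
      Real.exp t ≤ C * (1 + t) ^ 4 * ‖w t‖ ^ 2 := by
  have hre : ∀ t, HasDerivAt (fun s => (w s).re) (w₁ t).re t := fun t =>
    (Complex.reCLM.hasFDerivAt.comp_hasDerivAt t (hw t))
  have him : ∀ t, HasDerivAt (fun s => (w s).im) (w₁ t).im t := fun t =>
    (Complex.imCLM.hasFDerivAt.comp_hasDerivAt t (hw t))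
  have hre₁ : ∀ t, HasDerivAt (fun s => (w₁ s).re) (t * (w t).im) t := fun t => by
    have := (Complex.reCLM.hasFDerivAt.comp_hasDerivAt t (hw₁ t))
    convert! this using 1
    simp
  have him₁ : ∀ t, HasDerivAt (fun s => (w₁ s).im) (-(t * (w t).re)) t := fun t => by
    have := (Complex.imCLM.hasFDerivAt.comp_hasDerivAt t (hw₁ t))
    convert! this using 1
    simp
  have hsq : ∀ z : ℂ, ‖z‖ ^ 2 = z.re * z.re + z.im * z.im := fun z => by
    rw [← Complex.normSq_eq_norm_sq, Complex.normSq_apply]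
  simp only [hsq]
  refine exists_growth_bound (P := fun t => (w t).re * (w t).re + (w t).im * (w t).im)
    (Q := fun t => (w₁ t).re * (w₁ t).re + (w₁ t).im * (w₁ t).im)
    (A := fun t => (w₁ t).re * (w t).re + (w₁ t).im * (w t).im)
    (B := fun t => (w₁ t).re * (w t).im - (w₁ t).im * (w t).re)
    (fun t => ?_) (fun t => ?_) (fun t => ?_) (fun t => ?_) (fun t => ?_) (fun t => ?_) ?_ ?_ ?_
  · convert! ((hre t).mul (hre t)).add ((him t).mul (him t)) using 1; ring
  · convert! ((hre₁ t).mul (hre t)).add ((him₁ t).mul (him t)) using 1; ring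
  · convert! ((hre₁ t).mul (him t)).sub ((him₁ t).mul (hre t)) using 1; ring
  · convert! ((hre₁ t).mul (hre₁ t)).add ((him₁ t).mul (him₁ t)) using 1; ring
  · nlinarith [sq_nonneg ((w₁ t).re - (w t).re), sq_nonneg ((w₁ t).im - (w t).im)]
  · exact add_nonneg (mul_self_nonneg _) (mul_self_nonneg _)
  · simpa [hw0] using ha
  · simp [hw0, hw₁0]
  · simp [hw0, hw₁0]; linarith

/-- `Φ = 1 / Ai` and `U = Ai' / Ai` along the imaginary axis, with rapid decay of `Φ`. -/
structure IsAiryReciprocal (U Φ : ℝ → ℂ) : Prop where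
  hasDerivAt_logDeriv : ∀ t : ℝ, HasDerivAt U (Complex.I * (Complex.I * t - U t ^ 2)) t
  hasDerivAt_recip : ∀ t : ℝ, HasDerivAt Φ (-(Complex.I * U t * Φ t)) t
  bounded : ∀ k j : ℕ, ∃ C, ∀ t : ℝ, ‖U t ^ k * (Complex.I * t) ^ j * Φ t‖ ≤ C

/-- The monomial `u ^ k * z ^ j / Ai z` at `z = i t`. -/
noncomputable def monomialFun (U Φ : ℝ → ℂ) (k j : ℕ) (t : ℝ) : ℂ := U t ^ k * (Complex.I * t) ^ j * Φ t

/-- Rational combinations of monomials of weight at most `n` and congruent to `n` modulo `3`,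
where `u` has weight `1` and `z` has weight `2`. -/
noncomputable def weightSpan (U Φ : ℝ → ℂ) (n : ℕ) : Submodule ℚ (ℝ → ℂ) :=
  Submodule.span ℚ {F | ∃ k j, k + 2 * j ≤ n ∧ (k + 2 * j) % 3 = n % 3 ∧ F = monomialFun U Φ k j}

theorem monomialFun_mem_weightSpan (U Φ : ℝ → ℂ) {n k j : ℕ} (h : k + 2 * j ≤ n)
    (h' : (k + 2 * j) % 3 = n % 3) : monomialFun U Φ k j ∈ weightSpan U Φ n :=
  Submodule.subset_span ⟨k, j, h, h', rfl⟩

namespace IsAiryReciprocal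

variable {U Φ : ℝ → ℂ}

theorem hasDerivAt_monomialFun (h : IsAiryReciprocal U Φ) (k j : ℕ) (t : ℝ) :
    HasDerivAt (monomialFun U Φ k j)
      (Complex.I * (((k : ℚ) • monomialFun U Φ (k - 1) (j + 1)
        - (k + 1 : ℚ) • monomialFun U Φ (k + 1) j
        + (j : ℚ) • monomialFun U Φ k (j - 1)) t)) t := by
  have hz : HasDerivAt (fun s : ℝ => Complex.I * (s : ℂ)) Complex.I t := by
    simpa using (Complex.ofRealCLM.hasDerivAt (x := t)).const_mul Complex.I
  have := (((h.hasDerivAt_logDeriv t).pow k).mul (hz.pow j)).mul (h.hasDerivAt_recip t)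
  convert! this using 1
  simp only [Pi.add_apply, Pi.sub_apply, Pi.smul_apply, Pi.mul_apply, Pi.pow_apply, monomialFun,
    Rat.smul_def]
  push_cast
  rcases k with _ | k <;> rcases j with _ | j <;> simp <;> ring

theorem continuous_monomialFun (h : IsAiryReciprocal U Φ) (k j : ℕ) :
    Continuous (monomialFun U Φ k j) :=
  continuous_iff_continuousAt.2 fun t => (h.hasDerivAt_monomialFun k j t).continuousAt

theorem continuous_recip (h : IsAiryReciprocal U Φ) : Continuous Φ :=
  continuous_iff_continuousAt.2 fun t => (h.hasDerivAt_recip t).continuousAt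

theorem integrable_monomialFun_mul (h : IsAiryReciprocal U Φ) (k j : ℕ) :
    MeasureTheory.Integrable (fun t => monomialFun U Φ k j t * Φ t) := by
  obtain ⟨C₀, hC₀⟩ := h.bounded k j
  obtain ⟨C₂, hC₂⟩ := h.bounded k (j + 2)
  obtain ⟨D, hD⟩ := h.bounded 0 0
  refine (integrable_inv_one_add_sq.const_mul ((C₀ + C₂) * D)).mono'
    ((h.continuous_monomialFun k j).mul h.continuous_recip).aestronglyMeasurable
    (Filter.Eventually.of_forall fun t => ?_)
  have h0 : ‖monomialFun U Φ k j t‖ ≤ C₀ := hC₀ t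
  have h2 : t ^ 2 * ‖monomialFun U Φ k j t‖ ≤ C₂ := by
    refine le_trans (le_of_eq ?_) (hC₂ t)
    simp only [monomialFun, norm_mul, norm_pow, Complex.norm_I, Complex.norm_real, one_mul,
      Real.norm_eq_abs]
    rw [← sq_abs]; ring
  have hd : ‖Φ t‖ ≤ D := by simpa using hD t
  have h3 : 0 < 1 + t ^ 2 := by positivity
  rw [norm_mul, ← div_eq_mul_inv, le_div_iff₀ h3]
  have h4 : ‖monomialFun U Φ k j t‖ * (1 + t ^ 2) ≤ C₀ + C₂ := by linarith
  calc ‖monomialFun U Φ k j t‖ * ‖Φ t‖ * (1 + t ^ 2)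
      = ‖monomialFun U Φ k j t‖ * (1 + t ^ 2) * ‖Φ t‖ := by ring
    _ ≤ (C₀ + C₂) * D := by
      gcongr
      exact le_trans (by positivity) h4

theorem exists_hasDerivAt_of_mem_weightSpan (h : IsAiryReciprocal U Φ) {n : ℕ} {F : ℝ → ℂ}
    (hF : F ∈ weightSpan U Φ n) :
    ∃ G ∈ weightSpan U Φ (n + 1), ∀ t, HasDerivAt F (Complex.I * G t) t := by
  induction hF using Submodule.span_induction with
  | mem F hF =>
    obtain ⟨k, j, hn, hmod, rfl⟩ := hF
    refine ⟨_, ?_, h.hasDerivAt_monomialFun k j⟩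
    refine Submodule.add_mem _ (Submodule.sub_mem _ ?_ ?_) ?_
    · rcases k with _ | k
      · simp
      · exact Submodule.smul_mem _ _ (monomialFun_mem_weightSpan U Φ (by omega) (by omega))
    · exact Submodule.smul_mem _ _ (monomialFun_mem_weightSpan U Φ (by omega) (by omega))
    · rcases j with _ | j
      · simp
      · exact Submodule.smul_mem _ _ (monomialFun_mem_weightSpan U Φ (by omega) (by omega))
  | zero => exact ⟨0, Submodule.zero_mem _, fun t => by simp⟩
  | add F₁ F₂ _ _ h₁ h₂ =>
    obtain ⟨G₁, hG₁, hd₁⟩ := h₁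
    obtain ⟨G₂, hG₂, hd₂⟩ := h₂
    refine ⟨G₁ + G₂, Submodule.add_mem _ hG₁ hG₂, fun t => ?_⟩
    convert! (hd₁ t).add (hd₂ t) using 1
    simp [mul_add]
  | smul c F _ h₁ =>
    obtain ⟨G, hG, hd⟩ := h₁
    refine ⟨c • G, Submodule.smul_mem _ c hG, fun t => ?_⟩
    have h2 := (hd t).const_mul (c : ℂ)
    have e : c • F = fun s => (c : ℂ) * F s := by ext s; simp [Rat.smul_def]
    rw [e]
    convert! h2 using 1
    simp [Rat.smul_def]; ring

theorem exists_iteratedDeriv_eq (h : IsAiryReciprocal U Φ) (n : ℕ) :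
    ∃ G ∈ weightSpan U Φ n, iteratedDeriv n Φ = fun t => Complex.I ^ n * G t := by
  induction n with
  | zero =>
    refine ⟨monomialFun U Φ 0 0, monomialFun_mem_weightSpan U Φ (by simp) (by simp), ?_⟩
    ext t; simp [monomialFun]
  | succ n ih =>
    obtain ⟨G, hG, hGn⟩ := ih
    obtain ⟨G', hG', hd⟩ := h.exists_hasDerivAt_of_mem_weightSpan hG
    refine ⟨G', hG', ?_⟩
    rw [iteratedDeriv_succ, hGn]
    ext t
    rw [((hd t).const_mul _).deriv]; ring

theorem exists_pow_mul_norm_le (h : IsAiryReciprocal U Φ) {n : ℕ} {F : ℝ → ℂ}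
    (hF : F ∈ weightSpan U Φ n) (m : ℕ) : ∃ C, ∀ t : ℝ, |t| ^ m * ‖F t‖ ≤ C := by
  induction hF using Submodule.span_induction with
  | mem F hF =>
    obtain ⟨k, j, -, -, rfl⟩ := hF
    obtain ⟨C, hC⟩ := h.bounded k (j + m)
    refine ⟨C, fun t => le_trans (le_of_eq ?_) (hC t)⟩
    simp only [monomialFun, norm_mul, norm_pow, Complex.norm_I, Complex.norm_real, one_mul,
      Real.norm_eq_abs]
    ring
  | zero => exact ⟨0, fun t => by simp⟩
  | add F₁ F₂ _ _ h₁ h₂ =>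
    obtain ⟨C₁, hC₁⟩ := h₁
    obtain ⟨C₂, hC₂⟩ := h₂
    refine ⟨C₁ + C₂, fun t => le_trans ?_ (add_le_add (hC₁ t) (hC₂ t))⟩
    rw [← mul_add]
    exact mul_le_mul_of_nonneg_left (norm_add_le _ _) (by positivity)
  | smul c F _ h₁ =>
    obtain ⟨C, hC⟩ := h₁
    refine ⟨‖(c : ℂ)‖ * C, fun t => le_trans (le_of_eq ?_)
      (mul_le_mul_of_nonneg_left (hC t) (norm_nonneg (c : ℂ)))⟩
    simp only [Pi.smul_apply, Rat.smul_def, norm_mul]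
    ring

theorem exists_schwartzMap_eq (h : IsAiryReciprocal U Φ) : ∃ s : 𝓢(ℝ, ℂ), ⇑s = Φ := by
  refine ⟨⟨Φ, ?_, ?_⟩, rfl⟩
  · refine contDiff_of_differentiable_iteratedDeriv fun m _ t => ?_
    obtain ⟨G, hG, hGn⟩ := h.exists_iteratedDeriv_eq m
    obtain ⟨G', -, hd⟩ := h.exists_hasDerivAt_of_mem_weightSpan hG
    rw [hGn]
    exact ((hd t).const_mul _).differentiableAt
  · intro m n
    obtain ⟨G, hG, hGn⟩ := h.exists_iteratedDeriv_eq n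
    obtain ⟨C, hC⟩ := h.exists_pow_mul_norm_le hG m
    refine ⟨C, fun t => ?_⟩
    rw [norm_iteratedFDeriv_eq_norm_iteratedDeriv, hGn]
    simpa using hC t

/-- The integrals of `z ^ j / Ai z ^ 2` over the imaginary axis, for weights up to `n` and
congruent to `n` modulo `3`. -/
noncomputable def momentSpan (Φ : ℝ → ℂ) (n : ℕ) : Submodule ℚ ℂ :=
  Submodule.span ℚ {c | ∃ j : ℕ, 2 * j ≤ n ∧ 2 * j % 3 = n % 3 ∧
    c = ∫ t : ℝ, (Complex.I * t) ^ j * Φ t ^ 2}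

theorem integral_monomialFun_succ (h : IsAiryReciprocal U Φ) (k j : ℕ) :
    ((k + 2 : ℚ)) • ∫ t, monomialFun U Φ (k + 1) j t * Φ t =
      (k : ℚ) • (∫ t, monomialFun U Φ (k - 1) (j + 1) t * Φ t) +
        (j : ℚ) • ∫ t, monomialFun U Φ k (j - 1) t * Φ t := by
  have hi := h.integrable_monomialFun_mul
  have hi' : MeasureTheory.Integrable (fun t => Complex.I *
      ((k : ℂ) * (monomialFun U Φ (k - 1) (j + 1) t * Φ t) +
        (j : ℂ) * (monomialFun U Φ k (j - 1) t * Φ t) -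
        (k + 2 : ℂ) * (monomialFun U Φ (k + 1) j t * Φ t))) :=
    ((((hi _ _).const_mul _).add ((hi _ _).const_mul _)).sub ((hi _ _).const_mul _)).const_mul _
  have key := MeasureTheory.integral_eq_zero_of_hasDerivAt_of_integrable
    (f := fun t => monomialFun U Φ k j t * Φ t) (fun t => ?_) hi' (hi k j)
  · have hi'' : MeasureTheory.Integrable (fun t =>
        (k : ℂ) * (monomialFun U Φ (k - 1) (j + 1) t * Φ t) +
          (j : ℂ) * (monomialFun U Φ k (j - 1) t * Φ t)) :=
      ((hi _ _).const_mul _).add ((hi _ _).const_mul _)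
    rw [MeasureTheory.integral_const_mul,
      MeasureTheory.integral_sub hi'' ((hi _ _).const_mul _),
      MeasureTheory.integral_add ((hi _ _).const_mul _) ((hi _ _).const_mul _)] at key
    simp only [MeasureTheory.integral_const_mul] at key
    have := (mul_eq_zero.1 key).resolve_left Complex.I_ne_zero
    simp only [Rat.smul_def]
    push_cast
    linear_combination -this
  · convert! (h.hasDerivAt_monomialFun k j t).mul (h.hasDerivAt_recip t) using 1
    simp only [Pi.add_apply, Pi.sub_apply, Pi.smul_apply, Rat.smul_def]
    simp only [monomialFun]
    push_cast
    ring

theorem integral_monomialFun_mem (h : IsAiryReciprocal U Φ) (n k : ℕ) :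
    ∀ j, k + 2 * j ≤ n → (k + 2 * j) % 3 = n % 3 →
      ∫ t, monomialFun U Φ k j t * Φ t ∈ momentSpan Φ n := by
  induction k using Nat.strong_induction_on with
  | _ k ih =>
    intro j hn hmod
    rcases k with _ | k
    · refine Submodule.subset_span ⟨j, by omega, by omega, ?_⟩
      congr 1; ext t; simp [monomialFun]; ring
    · have hk : (k + 2 : ℚ) ≠ 0 := by positivity
      refine ((momentSpan Φ n).smul_mem_iff hk).1 ?_
      rw [h.integral_monomialFun_succ]
      refine Submodule.add_mem _ ?_ ?_
      · rcases k with _ | k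
        · simp
        · exact Submodule.smul_mem _ _ (ih _ (by omega) _ (by omega) (by omega))
      · rcases j with _ | j
        · simp
        · exact Submodule.smul_mem _ _ (ih _ (by omega) _ (by omega) (by omega))

theorem integral_mem_momentSpan (h : IsAiryReciprocal U Φ) {n : ℕ} {F : ℝ → ℂ}
    (hF : F ∈ weightSpan U Φ n) :
    MeasureTheory.Integrable (fun t => F t * Φ t) ∧ ∫ t, F t * Φ t ∈ momentSpan Φ n := by
  induction hF using Submodule.span_induction with
  | mem F hF =>
    obtain ⟨k, j, hn, hmod, rfl⟩ := hF
    exact ⟨h.integrable_monomialFun_mul k j, h.integral_monomialFun_mem n k j hn hmod⟩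
  | zero => simp
  | add F₁ F₂ _ _ h₁ h₂ =>
    simp only [Pi.add_apply, add_mul]
    refine ⟨h₁.1.add h₂.1, ?_⟩
    rw [MeasureTheory.integral_add h₁.1 h₂.1]
    exact Submodule.add_mem _ h₁.2 h₂.2
  | smul c F _ h₁ =>
    simp only [Pi.smul_apply, Rat.smul_def, mul_assoc]
    refine ⟨h₁.1.const_mul _, ?_⟩
    rw [MeasureTheory.integral_const_mul, ← Rat.smul_def]
    exact Submodule.smul_mem _ _ h₁.2

theorem exists_polynomial_of_mem_momentSpan (h : IsAiryReciprocal U Φ) {n : ℕ} {c : ℂ}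
    (hc : c ∈ momentSpan Φ n) :
    ∃ p : Polynomial ℚ, (∀ j, p.coeff j ≠ 0 → 2 * j ≤ n ∧ 2 * j % 3 = n % 3) ∧
      MeasureTheory.Integrable
        (fun t : ℝ => Polynomial.aeval (Complex.I * (t : ℂ)) p * Φ t ^ 2) ∧
      c = ∫ t : ℝ, Polynomial.aeval (Complex.I * (t : ℂ)) p * Φ t ^ 2 := by
  induction hc using Submodule.span_induction with
  | mem c hc =>
    obtain ⟨j, hn, hmod, rfl⟩ := hc
    refine ⟨Polynomial.X ^ j, fun i hi => ?_, ?_, by simp⟩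
    · rw [Polynomial.coeff_X_pow] at hi
      obtain rfl : i = j := by by_contra hij; simp [hij] at hi
      exact ⟨hn, hmod⟩
    · refine (h.integrable_monomialFun_mul 0 j).congr (Filter.Eventually.of_forall fun t => ?_)
      simp [monomialFun]; ring
  | zero => exact ⟨0, by simp, by simp, by simp⟩
  | add c₁ c₂ _ _ h₁ h₂ =>
    obtain ⟨p₁, hp₁, hi₁, rfl⟩ := h₁
    obtain ⟨p₂, hp₂, hi₂, rfl⟩ := h₂
    simp only [← MeasureTheory.integral_add hi₁ hi₂]
    refine ⟨p₁ + p₂, fun j hj => ?_, ?_, ?_⟩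
    · rw [Polynomial.coeff_add] at hj
      by_cases h0 : p₁.coeff j = 0
      · exact hp₂ j fun h' => hj (by simp [h0, h'])
      · exact hp₁ j h0
    · simp only [map_add, add_mul]
      exact hi₁.add hi₂
    · simp only [map_add, add_mul]
  | smul q c _ h₁ =>
    obtain ⟨p, hp, hi, rfl⟩ := h₁
    refine ⟨q • p, fun j hj => hp j fun h' => hj (by simp [h']), ?_, ?_⟩
    · simp only [map_smul, Rat.smul_def, mul_assoc]
      exact hi.const_mul _
    · simp only [map_smul, Rat.smul_def, mul_assoc, MeasureTheory.integral_const_mul]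

end IsAiryReciprocal

theorem exists_schwartzMap_iteratedDeriv (s : 𝓢(ℝ, ℂ)) (n : ℕ) :
    ∃ r : 𝓢(ℝ, ℂ), ⇑r = iteratedDeriv n s := by
  induction n with
  | zero => exact ⟨s, by simp⟩
  | succ n ih =>
    obtain ⟨r, hr⟩ := ih
    refine ⟨SchwartzMap.derivCLM ℂ ℂ r, ?_⟩
    ext x
    rw [SchwartzMap.derivCLM_apply, iteratedDeriv_succ, hr]

theorem integral_pow_mul_fourier_mul_fourier_neg (s : 𝓢(ℝ, ℂ)) (n : ℕ) :
    ∫ x : ℝ, (2 * π * x : ℂ) ^ n * (𝓕 (s : ℝ → ℂ) x * 𝓕 (s : ℝ → ℂ) (-x)) =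
      (-Complex.I) ^ n * ∫ t, iteratedDeriv n s t * s t := by
  obtain ⟨r, hr⟩ := exists_schwartzMap_iteratedDeriv s n
  have h1 : ∀ x : ℝ, 𝓕 r x = (2 * π * Complex.I * x) ^ n * 𝓕 (s : ℝ → ℂ) x := fun x => by
    rw [SchwartzMap.fourier_coe, hr,
      Real.fourier_iteratedDeriv (N := ⊤) (s.smooth ⊤) (fun m _ => ?_) le_top]
    · simp
    · obtain ⟨r', hr'⟩ := exists_schwartzMap_iteratedDeriv s m
      rw [← hr']; exact r'.integrable
  have h2 : ∀ x : ℝ, 𝓕 (s : ℝ → ℂ) (-x) = 𝓕⁻ s x := fun x => by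
    rw [SchwartzMap.fourierInv_coe, Real.fourierInv_eq_fourier_neg]
  have h3 := SchwartzMap.integral_fourier_mul_eq r (𝓕⁻ s)
  rw [FourierTransform.fourier_fourierInv_eq] at h3
  rw [← hr, ← h3, ← MeasureTheory.integral_const_mul]
  congr 1
  ext x
  rw [h1, h2]
  have hI : (-Complex.I) ^ n * Complex.I ^ n = 1 := by
    rw [← mul_pow]; simp
  simp only [mul_pow]
  linear_combination (-(2 ^ n * (π : ℂ) ^ n * (x : ℂ) ^ n * 𝓕 (s : ℝ → ℂ) x * 𝓕⁻ s x)) * hI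

theorem integral_pow_mul_eq (s : 𝓢(ℝ, ℂ)) {g : ℝ → ℝ}
    (hg : ∀ x : ℝ, (g x : ℂ) = (1 / (2 * (π : ℂ))) *
      ∫ t : ℝ, Complex.exp (-(Complex.I * t * x)) * ((Real.sqrt 2 : ℂ) * s t)) (n : ℕ) :
    ((∫ x : ℝ, x ^ n * (1 / 2 * g x * g (-x)) : ℝ) : ℂ) =
      1 / (2 * (π : ℂ)) * ((-Complex.I) ^ n * ∫ t, iteratedDeriv n s t * s t) := by
  have hπ : (π : ℂ) ≠ 0 := Complex.ofReal_ne_zero.2 Real.pi_ne_zero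
  have hg' : ∀ x : ℝ, (g x : ℂ) = Real.sqrt 2 / (2 * (π : ℂ)) * 𝓕 (s : ℝ → ℂ) (x / (2 * π)) := by
    intro x
    rw [hg, Real.fourier_real_eq_integral_exp_smul, div_mul_eq_mul_div, div_mul_eq_mul_div, one_mul,
      ← MeasureTheory.integral_const_mul]
    congr 2
    ext t
    have : (((-2 * π * t * (x / (2 * π)) : ℝ)) : ℂ) * Complex.I = -(Complex.I * t * x) := by
      push_cast; field_simp
    rw [this, smul_eq_mul]; ring
  have h2 : (Real.sqrt 2 : ℂ) ^ 2 = 2 := by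
    rw [← Complex.ofReal_pow, Real.sq_sqrt (by norm_num)]; norm_num
  rw [← integral_complex_ofReal, ← integral_pow_mul_fourier_mul_fourier_neg]
  let F : ℝ → ℂ := fun y => 1 / (2 * (π : ℂ)) ^ 2 *
    ((2 * π * y : ℂ) ^ n * (𝓕 (s : ℝ → ℂ) y * 𝓕 (s : ℝ → ℂ) (-y)))
  have e : ∀ x : ℝ, ((x ^ n * (1 / 2 * g x * g (-x)) : ℝ) : ℂ) =
      F (x / (2 * π)) := by
    intro x
    simp only [F]
    push_cast
    rw [hg', hg', neg_div, mul_div_cancel₀ _ (by simp : (2 * (π : ℂ)) ≠ 0)]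
    field_simp
    rw [h2]
  rw [MeasureTheory.integral_congr_ae (Filter.Eventually.of_forall e),
    MeasureTheory.Measure.integral_comp_div F, MeasureTheory.integral_const_mul,
    abs_of_pos (by positivity), Complex.real_smul]
  push_cast
  field_simp

theorem isAiryReciprocal_of_bound {w w₁ : ℝ → ℂ} {C : ℝ}
    (hw : ∀ t, HasDerivAt w (Complex.I * w₁ t) t)
    (hw₁ : ∀ t : ℝ, HasDerivAt w₁ (Complex.I * (Complex.I * t * w t)) t)
    (hpos : ∀ t, 0 < ‖w t‖ ^ 2)
    (hC₁ : ∀ t, ‖w₁ t‖ ^ 2 ≤ C * (1 + |t|) ^ 4 * ‖w t‖ ^ 2)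
    (hC : ∀ t, Real.exp |t| ≤ C * (1 + |t|) ^ 4 * ‖w t‖ ^ 2) :
    IsAiryReciprocal (fun t => w₁ t / w t) (fun t => (w t)⁻¹) := by
  have hne : ∀ t, w t ≠ 0 := fun t h0 => by simpa [h0] using hpos t
  refine ⟨fun t => ?_, fun t => ?_, fun k j => ?_⟩
  · convert! (hw₁ t).div (hw t) (hne t) using 1
    have := hne t
    field_simp
  · convert! (hw t).inv (hne t) using 1
    have := hne t
    field_simp
  · have hC0 : 0 ≤ C := by
      have h := (Real.exp_pos |(0 : ℝ)|).le.trans (hC 0)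
      simp only [abs_zero, add_zero, one_pow, mul_one] at h
      exact nonneg_of_mul_nonneg_left h (hpos 0)
    set m := 4 * k + 2 * j + 4 with hm
    refine ⟨Real.sqrt (C ^ (k + 1) * (m.factorial * Real.exp 1)), fun t => ?_⟩
    refine Real.le_sqrt_of_sq_le ?_
    have h1 : 0 ≤ 1 + |t| := by positivity
    have hU : ‖w₁ t / w t‖ ^ 2 ≤ C * (1 + |t|) ^ 4 := by
      rw [norm_div, div_pow, div_le_iff₀ (hpos t)]
      exact hC₁ t
    have hΦ : ‖(w t)⁻¹‖ ^ 2 ≤ C * (1 + |t|) ^ 4 * (Real.exp |t|)⁻¹ := by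
      rw [norm_inv, inv_pow, ← div_eq_mul_inv, le_div_iff₀ (Real.exp_pos _),
        inv_mul_le_iff₀ (hpos t), mul_comm]
      exact hC t
    have ht : |t| ^ 2 ≤ (1 + |t|) ^ 2 := by gcongr; linarith
    have hexp : (1 + |t|) ^ m ≤ m.factorial * Real.exp 1 * Real.exp |t| := by
      have := Real.pow_div_factorial_le_exp _ h1 m
      rwa [div_le_iff₀' (by positivity), Real.exp_add, ← mul_assoc] at this
    calc ‖(w₁ t / w t) ^ k * (Complex.I * t) ^ j * (w t)⁻¹‖ ^ 2
        = (‖w₁ t / w t‖ ^ 2) ^ k * (|t| ^ 2) ^ j * ‖(w t)⁻¹‖ ^ 2 := by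
          simp only [norm_mul, norm_pow, Complex.norm_I, Complex.norm_real, one_mul,
            Real.norm_eq_abs]
          ring
      _ ≤ (C * (1 + |t|) ^ 4) ^ k * ((1 + |t|) ^ 2) ^ j *
            (C * (1 + |t|) ^ 4 * (Real.exp |t|)⁻¹) := by gcongr
      _ = C ^ (k + 1) * ((1 + |t|) ^ m * (Real.exp |t|)⁻¹) := by
          rw [hm, mul_pow, ← pow_mul, ← pow_mul]; ring
      _ ≤ C ^ (k + 1) * (m.factorial * Real.exp 1) := by
          refine mul_le_mul_of_nonneg_left ?_ (by positivity)
          rw [← div_eq_mul_inv, div_le_iff₀ (Real.exp_pos _)]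
          exact hexp

theorem isAiryReciprocal_of_airy {Ai : ℂ → ℂ} (hAi_d1 : Differentiable ℂ Ai)
    (hAi_d2 : Differentiable ℂ (deriv Ai))
    (hAi_ode : ∀ z : ℂ, deriv (deriv Ai) z = z * Ai z) {a b : ℝ}
    (h0 : Ai 0 = a) (h1 : deriv Ai 0 = b) (ha : a ≠ 0) (hab : a * b ≤ 0) :
    IsAiryReciprocal (fun t => deriv Ai (Complex.I * t) / Ai (Complex.I * t))
      (fun t => (Ai (Complex.I * t))⁻¹) := by
  have hz : ∀ t : ℝ, HasDerivAt (fun s : ℝ => Complex.I * (s : ℂ)) Complex.I t := fun t => by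
    simpa using (Complex.ofRealCLM.hasDerivAt (x := t)).const_mul Complex.I
  have hw : ∀ t : ℝ, HasDerivAt (fun s : ℝ => Ai (Complex.I * s))
      (Complex.I * deriv Ai (Complex.I * t)) t := fun t => by
    convert! (hAi_d1 _).hasDerivAt.comp t (hz t) using 1
    ring
  have hw₁ : ∀ t : ℝ, HasDerivAt (fun s : ℝ => deriv Ai (Complex.I * s))
      (Complex.I * (Complex.I * t * Ai (Complex.I * t))) t := fun t => by
    convert! (hAi_d2 _).hasDerivAt.comp t (hz t) using 1
    rw [hAi_ode]; ring
  obtain ⟨C₁, hC₁⟩ := exists_bound_of_airy_ode hw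
    (fun t => by
      convert! (hw₁ t).const_mul Complex.I using 1
      linear_combination (-Complex.I * t * Ai (Complex.I * t)) * Complex.I_mul_I)
    (by simpa using h0) (by simp [h1]) ha hab
  have hneg : ∀ {F : ℝ → ℂ} {F' : ℂ} {t : ℝ}, HasDerivAt F F' (-t) →
      HasDerivAt (fun s => (starRingEnd ℂ) (F (-s))) (-(starRingEnd ℂ) F') t :=
    fun {F F' t} hF => by
      have h2 := hF.scomp t (hasDerivAt_neg t)
      have h3 := Complex.conjCLE.toContinuousLinearMap.hasFDerivAt.comp_hasDerivAt t h2
      convert! h3 using 1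
      simp
  obtain ⟨C₂, hC₂⟩ := exists_bound_of_airy_ode (a := a) (b := b) (fun t => hneg (hw (-t)))
    (fun t => by
      convert! (hneg ((hw₁ (-t)).const_mul Complex.I)).neg using 1
      simp
      linear_combination (-Complex.I * t * (starRingEnd ℂ) (Ai (-(Complex.I * t)))) *
        Complex.I_mul_I)
    (by simp [h0]) (by simp [h1]) ha hab
  refine isAiryReciprocal_of_bound (C := max C₁ C₂) hw hw₁ (fun t => ?_) (fun t => ?_)
    (fun t => ?_)
  · rcases le_total 0 t with ht | ht
    · exact (hC₁ t ht).1
    · simpa using (hC₂ (-t) (neg_nonneg.2 ht)).1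
  · rcases le_total 0 t with ht | ht
    · have := (hC₁ t ht).2.1
      rw [abs_of_nonneg ht]
      refine le_trans (by simpa using this) ?_
      gcongr
      exact le_max_left _ _
    · have := (hC₂ (-t) (neg_nonneg.2 ht)).2.1
      rw [abs_of_nonpos ht]
      refine le_trans (by simpa using this) ?_
      have : 0 ≤ 1 + -t := by linarith
      gcongr
      exact le_max_right _ _
  · rcases le_total 0 t with ht | ht
    · have := (hC₁ t ht).2.2
      rw [abs_of_nonneg ht]
      refine le_trans (by simpa using this) ?_
      gcongr
      exact le_max_left _ _
    · have := (hC₂ (-t) (neg_nonneg.2 ht)).2.2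
      rw [abs_of_nonpos ht]
      refine le_trans (by simpa using this) ?_
      have : 0 ≤ 1 + -t := by linarith
      gcongr
      exact le_max_right _ _

end ChernoffMoment

theorem chernoff_even_moment_polynomial_mod_three (Ai : ℂ → ℂ)
    (hAi_d1 : Differentiable ℂ Ai)
    (hAi_d2 : Differentiable ℂ (deriv Ai))
    (hAi_ode : ∀ z : ℂ, deriv (deriv Ai) z = z * Ai z)
    (hAi_0 : Ai 0 = (3 : ℂ) ^ (-(2 : ℂ) / 3) / Complex.Gamma (2 / 3))
    (hAi_0' : deriv Ai 0 = -(3 : ℂ) ^ (-(1 : ℂ) / 3) / Complex.Gamma (1 / 3))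
    (hAi_zeros : ∀ z : ℂ, Ai z = 0 → ∃ x : ℝ, x < 0 ∧ z = (x : ℂ))
    (g : ℝ → ℝ)
    (hg : ∀ x : ℝ, (g x : ℂ) =
      (1 / (2 * (Real.pi : ℂ))) *
        ∫ t : ℝ, Complex.exp (-(Complex.I * t * x)) * ((Real.sqrt 2 : ℂ) / Ai (Complex.I * t)))
    (f : ℝ → ℝ)
    (hf : ∀ x : ℝ, f x = (1 / 2) * g x * g (-x)) :
    ∀ n : ℕ, 0 < n → Even n →
      ∃ p : Polynomial ℚ, p.natDegree ≤ n / 2 ∧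
        (∀ j : ℕ, p.coeff j ≠ 0 → j % 3 = (n / 2) % 3) ∧
        ((∫ x : ℝ, x ^ n * f x : ℝ) : ℂ) =
          (1 / (2 * (Real.pi : ℂ))) *
            ∫ y : ℝ, Polynomial.aeval (Complex.I * (y : ℂ)) p / (Ai (Complex.I * y)) ^ 2 := by
  intro n _ hn
  have h0 : Ai 0 = (((3 : ℝ) ^ (-(2 : ℝ) / 3) / Real.Gamma (2 / 3) : ℝ) : ℂ) := by
    rw [hAi_0, Complex.ofReal_div, Complex.ofReal_cpow (by norm_num), ← Complex.Gamma_ofReal]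
    push_cast; rfl
  have h1 : deriv Ai 0 = ((-(3 : ℝ) ^ (-(1 : ℝ) / 3) / Real.Gamma (1 / 3) : ℝ) : ℂ) := by
    rw [hAi_0', Complex.ofReal_div, Complex.ofReal_neg, Complex.ofReal_cpow (by norm_num),
      ← Complex.Gamma_ofReal]
    push_cast; rfl
  have hG1 : 0 < Real.Gamma (1 / 3) := Real.Gamma_pos_of_pos (by norm_num)
  have hG2 : 0 < Real.Gamma (2 / 3) := Real.Gamma_pos_of_pos (by norm_num)
  have hA := ChernoffMoment.isAiryReciprocal_of_airy hAi_d1 hAi_d2 hAi_ode h0 h1 (by positivity)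
    (mul_nonpos_of_nonneg_of_nonpos (by positivity)
      (div_nonpos_of_nonpos_of_nonneg (neg_nonpos.2 (by positivity)) hG1.le))
  obtain ⟨s, hs⟩ := hA.exists_schwartzMap_eq
  obtain ⟨G, hG, hGn⟩ := hA.exists_iteratedDeriv_eq n
  obtain ⟨p, hp, -, hpG⟩ :=
    hA.exists_polynomial_of_mem_momentSpan (hA.integral_mem_momentSpan hG).2
  refine ⟨p, ?_, fun j hj => ?_, ?_⟩
  · rw [Polynomial.natDegree_le_iff_coeff_eq_zero]
    intro j hj
    by_contra h
    have := (hp j h).1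
    omega
  · have := (hp j hj).2
    obtain ⟨m, rfl⟩ := hn
    omega
  · have key := ChernoffMoment.integral_pow_mul_eq s (g := g)
      (fun x => by rw [hg, hs]; simp only [div_eq_mul_inv]) n
    simp only [hf]
    rw [key, hs, hGn]
    have hI : (-Complex.I) ^ n * Complex.I ^ n = 1 := by
      rw [← mul_pow]; simp
    simp only [mul_assoc, MeasureTheory.integral_const_mul]
    rw [hpG, ← mul_assoc ((-Complex.I) ^ n), hI, one_mul]
    simp only [inv_pow, div_eq_mul_inv]
end
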